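/- arXiv:0706.1101 — 2 statements merged into one kernel-verified Lean document; each statement's English description precedes it below -/
import Mathlib

section
/- Let A ⊆ ℝ be a Borel set with |A| > 0, and let H be a Herglotz function whose boundary values satisfy Re H(t) = 0 for Lebesgue-almost every t ∈ A, with Herglotz representation H(z) = a + ∫_{ℝ∞} (1+tz)/(t−z) dν(t). Let F₊ be a Herglotz function and put F₋ = H − F₊. Then the following are equivalent: (a) F₋ is a Herglotz function and the boundary values satisfy F₊(t) = −conj(F₋(t)) for almost every t ∈ A; (b) there exist a₊ ∈ ℝ and a Borel measurable function f : ℝ∞ → [0,1] with f(t) = 1/2 for Lebesgue-almost every t ∈ A, such that F₊(z) = a₊ + ∫_{ℝ∞} (1+tz)/(t−z) f(t) dν(t) for all z ∈ ℂ⁺. -/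
open Filter Topology MeasureTheory Complex

/-- A Herglotz function: a holomorphic map of the upper half plane to itself. -/
def IsHerglotz (F : ℂ → ℂ) : Prop :=
  DifferentiableOn ℂ F {z : ℂ | 0 < z.im} ∧ ∀ z : ℂ, 0 < z.im → 0 < (F z).im

noncomputable instance : MeasurableSpace (OnePoint ℝ) := borel _
instance : BorelSpace (OnePoint ℝ) := ⟨rfl⟩

/-- The kernel (1+tz)/(t-z) of the Herglotz representation, interpreted as z at t = ∞. -/
noncomputable def herglotzKernel (z : ℂ) : OnePoint ℝ → ℂ :=
  fun t => Option.elim t z (fun s : ℝ => (1 + s * z) / (s - z))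

/-- The Cayley transform of `OnePoint ℝ` onto the unit circle, sending `∞` to `1`. -/
noncomputable def cayley : OnePoint ℝ → ℂ :=
  fun t => Option.elim t 1 (fun s : ℝ => (s - I) / (s + I))

lemma cayley_coe (s : ℝ) : cayley (s : OnePoint ℝ) = (s - I) / (s + I) := rfl

lemma cayley_infty : cayley OnePoint.infty = 1 := rfl

lemma herglotzKernel_coe (z : ℂ) (s : ℝ) :
    herglotzKernel z (s : OnePoint ℝ) = (1 + s * z) / (s - z) := rfl

lemma herglotzKernel_infty (z : ℂ) : herglotzKernel z OnePoint.infty = z := rfl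

lemma add_I_ne_zero_of_im_nonneg {z : ℂ} (hz : 0 ≤ z.im) : z + I ≠ 0 := by
  intro h
  have := congrArg Complex.im h
  simp at this
  linarith

lemma ofReal_sub_ne_zero_of_im_pos {z : ℂ} (hz : 0 < z.im) (s : ℝ) : (s : ℂ) - z ≠ 0 := by
  intro h
  have := congrArg Complex.im h
  simp at this
  linarith

lemma norm_cayley (t : OnePoint ℝ) : ‖cayley t‖ = 1 := by
  induction t using OnePoint.rec with
  | infty => simp [cayley_infty]
  | coe s =>
    have h : ‖(s : ℂ) - I‖ = ‖(s : ℂ) + I‖ := by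
      simp [Complex.norm_def, Complex.normSq_apply]
    rw [cayley_coe, norm_div, h, div_self]
    exact norm_ne_zero_iff.2 (add_I_ne_zero_of_im_nonneg (by simp))

lemma cayley_injective : Function.Injective cayley := by
  have hinf (s : ℝ) : cayley (s : OnePoint ℝ) ≠ 1 := by
    intro h
    rw [cayley_coe, div_eq_one_iff_eq (add_I_ne_zero_of_im_nonneg (by simp))] at h
    have := congrArg Complex.im h
    norm_num at this
  intro t t' h
  induction t using OnePoint.rec with
  | infty =>
    induction t' using OnePoint.rec with
    | infty => rfl
    | coe s => exact absurd h.symm (hinf s)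
  | coe s =>
    induction t' using OnePoint.rec with
    | infty => exact absurd h (hinf s)
    | coe s' =>
      rw [cayley_coe, cayley_coe, div_eq_div_iff (add_I_ne_zero_of_im_nonneg (by simp))
        (add_I_ne_zero_of_im_nonneg (by simp))] at h
      have := congrArg Complex.im h
      simp at this
      congr 1
      linarith

lemma tendsto_div_add_I_coclosedCompact :
    Tendsto (fun s : ℝ => 1 / ((s : ℂ) + I)) (coclosedCompact ℝ) (𝓝 0) := by
  rw [coclosedCompact_eq_cocompact]
  simp_rw [one_div]
  refine tendsto_inv₀_cobounded.comp ?_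
  rw [← tendsto_norm_atTop_iff_cobounded]
  refine tendsto_atTop_mono (f := fun s : ℝ => ‖s‖) (fun s => ?_) (tendsto_norm_cocompact_atTop)
  have := Complex.abs_re_le_norm ((s : ℂ) + I)
  simpa using this

lemma continuous_cayley : Continuous cayley := by
  rw [OnePoint.continuous_iff]
  simp only [cayley_coe, cayley_infty]
  constructor
  · have h : (fun s : ℝ => ((s : ℂ) - I) / (s + I)) =
        fun s : ℝ => 1 - 2 * I * (1 / ((s : ℂ) + I)) := by
      ext s
      have : (s : ℂ) + I ≠ 0 := add_I_ne_zero_of_im_nonneg (by simp)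
      field_simp
      ring
    rw [h]
    simpa using (tendsto_div_add_I_coclosedCompact.const_mul (2 * I)).const_sub 1
  · refine Continuous.div (by fun_prop) (by fun_prop) fun s =>
      add_I_ne_zero_of_im_nonneg (by simp)

lemma isClosedEmbedding_cayley : IsClosedEmbedding cayley :=
  continuous_cayley.isClosedEmbedding cayley_injective

instance : PolishSpace (OnePoint ℝ) := isClosedEmbedding_cayley.polishSpace

lemma exists_cayley_eq {ζ : ℂ} (hζ : ‖ζ‖ = 1) : ∃ t, cayley t = ζ := by
  by_cases h1 : ζ = 1
  · exact ⟨OnePoint.infty, by rw [h1, cayley_infty]⟩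
  · have hne : 1 - ζ ≠ 0 := sub_ne_zero.2 (Ne.symm h1)
    have hnorm : ζ.re ^ 2 + ζ.im ^ 2 = 1 := by
      have := Complex.sq_norm ζ
      rw [hζ, Complex.normSq_apply] at this
      linarith
    have hre : ζ.re ≠ 1 := by
      intro h
      apply h1
      apply Complex.ext
      · simpa using h
      · rw [h] at hnorm
        simpa using hnorm
    have h2 : (1 - ζ.re : ℝ) ≠ 0 := sub_ne_zero.2 (Ne.symm hre)
    obtain ⟨x, hx⟩ : ∃ x : ℝ, x * (1 - ζ.re) = -ζ.im := ⟨-ζ.im / (1 - ζ.re), div_mul_cancel₀ _ h2⟩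
    have hx' : x * ζ.im + ζ.re + 1 = 0 := by
      refine (mul_eq_zero_iff_left h2).1 ?_
      linear_combination ζ.im * hx - hnorm
    refine ⟨(x : OnePoint ℝ), ?_⟩
    rw [cayley_coe, div_eq_iff (add_I_ne_zero_of_im_nonneg (by simp))]
    apply Complex.ext
    · simp
      linarith
    · simp
      linarith

/-- The parametrisation of `OnePoint ℝ` by the angle on the unit circle. -/
noncomputable def cayleyAngle (θ : ℝ) : OnePoint ℝ :=
  (exists_cayley_eq (ζ := circleMap 0 1 θ) (by simp)).choose

lemma cayley_cayleyAngle (θ : ℝ) : cayley (cayleyAngle θ) = circleMap 0 1 θ :=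
  (exists_cayley_eq (ζ := circleMap 0 1 θ) (by simp)).choose_spec

lemma continuous_cayleyAngle : Continuous cayleyAngle := by
  rw [isClosedEmbedding_cayley.isInducing.continuous_iff]
  have : cayley ∘ cayleyAngle = circleMap 0 1 := funext cayley_cayleyAngle
  rw [this]
  exact continuous_circleMap 0 1

lemma norm_cayley_disc {z : ℂ} (hz : 0 < z.im) : ‖(z - I) / (z + I)‖ < 1 := by
  rw [norm_div, div_lt_one (norm_pos_iff.2 (add_I_ne_zero_of_im_nonneg hz.le))]
  rw [← sq_lt_sq₀ (norm_nonneg _) (norm_nonneg _), Complex.sq_norm, Complex.sq_norm]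
  simp [Complex.normSq_apply]
  nlinarith

lemma cayley_sub_ne_zero {w : ℂ} (hw : ‖w‖ < 1) (t : OnePoint ℝ) : cayley t - w ≠ 0 := by
  rw [sub_ne_zero]
  rintro rfl
  rw [norm_cayley] at hw
  exact lt_irrefl _ hw

/-- The inverse Cayley transform, from the unit disc to the upper half plane. -/
noncomputable def invCayley (w : ℂ) : ℂ := I * (1 + w) / (1 - w)

lemma one_sub_ne_zero_of_norm_lt {w : ℂ} (hw : ‖w‖ < 1) : 1 - w ≠ 0 := by
  rw [sub_ne_zero]
  rintro rfl
  simp at hw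

lemma invCayley_im_pos {w : ℂ} (hw : ‖w‖ < 1) : 0 < (invCayley w).im := by
  have h : (invCayley w).im = (1 - ‖w‖ ^ 2) / Complex.normSq (1 - w) := by
    rw [invCayley, Complex.div_im, Complex.sq_norm]
    have : Complex.normSq (1 - w) ≠ 0 := by simpa using one_sub_ne_zero_of_norm_lt hw
    field_simp
    simp [Complex.normSq_apply]
    ring
  rw [h]
  refine div_pos ?_ (Complex.normSq_pos.2 (one_sub_ne_zero_of_norm_lt hw))
  nlinarith [norm_nonneg w]

lemma invCayley_cayley_disc {z : ℂ} (hz : 0 < z.im) : invCayley ((z - I) / (z + I)) = z := by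
  have h := add_I_ne_zero_of_im_nonneg hz.le
  have h2 := one_sub_ne_zero_of_norm_lt (norm_cayley_disc hz)
  rw [invCayley, div_eq_iff h2]
  field_simp
  ring

lemma differentiableAt_invCayley {w : ℂ} (hw : ‖w‖ < 1) : DifferentiableAt ℂ invCayley w := by
  unfold invCayley
  exact DifferentiableAt.div (by fun_prop) (by fun_prop) (one_sub_ne_zero_of_norm_lt hw)

lemma herglotzKernel_invCayley {w : ℂ} (hw : ‖w‖ < 1) (t : OnePoint ℝ) :
    herglotzKernel (invCayley w) t = I * ((cayley t + w) / (cayley t - w)) := by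
  have h1 := one_sub_ne_zero_of_norm_lt hw
  induction t using OnePoint.rec with
  | infty => rw [herglotzKernel_infty, cayley_infty, invCayley, mul_div_assoc]
  | coe s =>
    have h2 := ofReal_sub_ne_zero_of_im_pos (invCayley_im_pos hw) s
    have h3 := cayley_sub_ne_zero hw (s : OnePoint ℝ)
    have h4 : (s : ℂ) + I ≠ 0 := add_I_ne_zero_of_im_nonneg (by simp)
    rw [cayley_coe] at h3
    rw [herglotzKernel_coe, cayley_coe, ← mul_div_assoc, div_eq_div_iff h2 h3, invCayley]
    field_simp
    have hI : I ^ 3 = -I := by rw [pow_succ, Complex.I_sq, neg_one_mul]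
    ring_nf
    simp only [Complex.I_sq, hI]
    ring

lemma continuous_herglotzKernel {z : ℂ} (hz : 0 < z.im) : Continuous (herglotzKernel z) := by
  rw [← invCayley_cayley_disc hz]
  have h := norm_cayley_disc hz
  simp_rw [funext (herglotzKernel_invCayley h)]
  exact continuous_const.mul (((continuous_cayley.add continuous_const)).div
    (continuous_cayley.sub continuous_const) (cayley_sub_ne_zero h))

lemma integrable_of_continuous_onePoint {E : Type*} [NormedAddCommGroup E]
    {ν : Measure (OnePoint ℝ)} [IsFiniteMeasure ν] {f : OnePoint ℝ → E} (hf : Continuous f) :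
    Integrable f ν :=
  hf.integrable_of_hasCompactSupport (HasCompactSupport.of_compactSpace f)

lemma integrable_herglotzKernel (ν : Measure (OnePoint ℝ)) [IsFiniteMeasure ν] {z : ℂ}
    (hz : 0 < z.im) : Integrable (herglotzKernel z) ν :=
  integrable_of_continuous_onePoint (continuous_herglotzKernel hz)

lemma hasFPowerSeriesOnBall_integral_cayley (ν : Measure (OnePoint ℝ)) [IsFiniteMeasure ν] :
    HasFPowerSeriesOnBall (fun w => ∫ t, cayley t / (cayley t - w) ∂ν)
      (FormalMultilinearSeries.ofScalars ℂ fun n => ∫ t, (cayley t)⁻¹ ^ n ∂ν) 0 1 := by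
  have hne (t : OnePoint ℝ) : cayley t ≠ 0 := norm_ne_zero_iff.1 (by simp [norm_cayley])
  have hcont (n : ℕ) : Continuous fun t => (cayley t)⁻¹ ^ n :=
    (continuous_cayley.inv₀ hne).pow n
  refine ⟨?_, one_pos, ?_⟩
  · refine FormalMultilinearSeries.le_radius_of_bound (r := 1) _ (ν.real Set.univ) fun n => ?_
    rw [FormalMultilinearSeries.ofScalars_norm]
    simp only [NNReal.coe_one, one_pow, mul_one]
    refine (norm_integral_le_integral_norm _).trans (le_of_eq ?_)
    simp [norm_cayley]
  · intro w hw
    have hw' : ‖w‖ < 1 := by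
      simpa [Metric.mem_eball, ← ENNReal.ofReal_one, edist_lt_ofReal] using hw
    have hs := hasSum_integral_of_summable_integral_norm (μ := ν)
      (F := fun n t => (cayley t)⁻¹ ^ n * w ^ n)
      (fun n => integrable_of_continuous_onePoint ((hcont n).mul continuous_const)) (by
        simp only [norm_mul, norm_pow, norm_inv, norm_cayley, inv_one, one_pow, one_mul,
          integral_const, smul_eq_mul]
        exact (summable_geometric_of_lt_one (norm_nonneg _) hw').mul_left _)
    simp only [FormalMultilinearSeries.ofScalars_apply_eq, zero_add, smul_eq_mul]
    convert hs using 1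
    · ext n
      rw [integral_mul_const]
    · refine integral_congr_ae (ae_of_all _ fun t => ?_)
      have h1 : ‖(cayley t)⁻¹ * w‖ < 1 := by simpa [norm_cayley] using hw'
      have h2 := cayley_sub_ne_zero hw' t
      have h3 := one_sub_ne_zero_of_norm_lt h1
      simp only [← mul_pow]
      rw [tsum_geometric_of_norm_lt_one h1, inv_eq_one_div, div_eq_div_iff h2 h3]
      have := hne t
      field_simp

lemma integral_herglotzKernel_invCayley (ν : Measure (OnePoint ℝ)) [IsFiniteMeasure ν] {w : ℂ}
    (hw : ‖w‖ < 1) :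
    ∫ t, herglotzKernel (invCayley w) t ∂ν
      = I * (2 * ∫ t, cayley t / (cayley t - w) ∂ν - ν.real Set.univ) := by
  have h (t : OnePoint ℝ) : herglotzKernel (invCayley w) t
      = I * (2 * (cayley t / (cayley t - w)) - 1) := by
    rw [herglotzKernel_invCayley hw]
    have := cayley_sub_ne_zero hw t
    field_simp
    ring
  have hint : Integrable (fun t => 2 * (cayley t / (cayley t - w))) ν :=
    integrable_of_continuous_onePoint (continuous_const.mul (continuous_cayley.div
      (continuous_cayley.sub continuous_const) (cayley_sub_ne_zero hw)))
  simp_rw [h]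
  rw [integral_const_mul, integral_sub hint (integrable_const _), integral_const_mul]
  simp

lemma differentiableOn_integral_herglotzKernel_invCayley (ν : Measure (OnePoint ℝ))
    [IsFiniteMeasure ν] :
    DifferentiableOn ℂ (fun w => ∫ t, herglotzKernel (invCayley w) t ∂ν) (Metric.ball 0 1) := by
  have h := (hasFPowerSeriesOnBall_integral_cayley ν).differentiableOn
  rw [← ENNReal.ofReal_one, Metric.eball_ofReal] at h
  refine DifferentiableOn.congr (f := fun w =>
    I * (2 * ∫ t, cayley t / (cayley t - w) ∂ν - ν.real Set.univ)) ?_ fun w hw =>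
      integral_herglotzKernel_invCayley ν (by simpa using hw)
  exact ((h.const_mul 2).sub_const _).const_mul I

lemma exists_measure_integral_eq_intervalIntegral {ρ : ℝ → ℝ} (hρ : Continuous ρ)
    (hρ0 : ∀ θ, 0 ≤ ρ θ) : ∃ μ : FiniteMeasure (OnePoint ℝ), ∀ φ : OnePoint ℝ → ℝ, Continuous φ →
      ∫ t, φ t ∂(μ : Measure (OnePoint ℝ))
        = ∫ θ in (0)..(2 * Real.pi), ρ θ * φ (cayleyAngle θ) := by
  set m : Measure ℝ := (volume.restrict (Set.Ioc 0 (2 * Real.pi))).withDensity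
    fun θ => ENNReal.ofReal (ρ θ)
  have hm : IsFiniteMeasure m := isFiniteMeasure_withDensity_ofReal
    ((hρ.integrableOn_Ioc).hasFiniteIntegral)
  refine ⟨⟨m.map cayleyAngle, inferInstance⟩, fun φ hφ => ?_⟩
  rw [FiniteMeasure.toMeasure_mk, integral_map continuous_cayleyAngle.measurable.aemeasurable
    hφ.aestronglyMeasurable, integral_withDensity_eq_integral_toReal_smul
    hρ.measurable.ennreal_ofReal (ae_of_all _ fun _ => ENNReal.ofReal_lt_top),
    intervalIntegral.integral_of_le (by positivity)]
  simp [ENNReal.toReal_ofReal (hρ0 _)]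

lemma exists_measure_poisson_of_differentiableOn_ball {g : ℂ → ℂ}
    (hg : DifferentiableOn ℂ g (Metric.ball 0 1)) (hpos : ∀ w, ‖w‖ < 1 → 0 < (g w).im)
    {r : ℝ} (hr0 : 0 ≤ r) (hr1 : r < 1) : ∃ μ : FiniteMeasure (OnePoint ℝ), ∀ w : ℂ, ‖w‖ < 1 →
      (g (r * w)).im = ∫ t, ((cayley t + w) / (cayley t - w)).re ∂(μ : Measure (OnePoint ℝ)) := by
  have hmem {w : ℂ} (hw : ‖w‖ ≤ 1) : ‖(r : ℂ) * w‖ < 1 := by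
    rw [norm_mul, Complex.norm_real, Real.norm_of_nonneg hr0]
    exact (mul_le_of_le_one_right hr0 hw).trans_lt hr1
  have hgr : DifferentiableOn ℂ (fun w => g (r * w)) (Metric.closedBall 0 1) :=
    hg.comp (by fun_prop) fun w hw => by simpa using hmem (by simpa using hw)
  have hc : Continuous fun θ : ℝ => g (r * circleMap 0 1 θ) :=
    hgr.continuousOn.comp_continuous (continuous_circleMap 0 1) fun θ => by simp
  have hDC : DiffContOnCl ℂ (fun w => g (r * w)) (Metric.ball 0 1) :=
    DifferentiableOn.diffContOnCl (by rwa [closure_ball _ one_ne_zero])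
  obtain ⟨μ, hμ⟩ := exists_measure_integral_eq_intervalIntegral
    (ρ := fun θ => (2 * Real.pi)⁻¹ * (g (r * circleMap 0 1 θ)).im)
    (continuous_const.mul (Complex.continuous_im.comp hc)) fun θ =>
      mul_nonneg (by positivity) (hpos _ (hmem (by simp))).le
  refine ⟨μ, fun w hw => ?_⟩
  have hcont : Continuous fun t => ((cayley t + w) / (cayley t - w)).re :=
    Complex.continuous_re.comp ((continuous_cayley.add continuous_const).div
      (continuous_cayley.sub continuous_const) (cayley_sub_ne_zero hw))
  have hP := hDC.circleAverage_re_herglotzRieszKernel_smul' (w := w) (by simpa using hw)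
  rw [hμ _ hcont, ← hP, Real.circleAverage_def, ← Complex.imCLM_apply, map_smul]
  have hcθ : Continuous fun θ : ℝ =>
      ((circleMap 0 1 θ - 0 + (w - 0)) / (circleMap 0 1 θ - 0 - (w - 0))).re •
        g (r * circleMap 0 1 θ) := by
    refine Continuous.fun_smul ?_ hc
    have := hcont.comp continuous_cayleyAngle
    simpa [Function.comp_def, cayley_cayleyAngle] using this
  rw [← ContinuousLinearMap.intervalIntegral_comp_comm _ (hcθ.intervalIntegrable _ _),
    ← intervalIntegral.integral_smul]
  refine intervalIntegral.integral_congr fun θ _ => ?_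
  simp only [cayley_cayleyAngle, Complex.imCLM_apply, Complex.real_smul, Complex.im_ofReal_mul,
    smul_eq_mul, sub_zero]
  ring

lemma exists_measure_im_eq_of_differentiableOn_ball {g : ℂ → ℂ}
    (hg : DifferentiableOn ℂ g (Metric.ball 0 1)) (hpos : ∀ w, ‖w‖ < 1 → 0 < (g w).im) :
    ∃ μ : FiniteMeasure (OnePoint ℝ), ∀ w : ℂ, ‖w‖ < 1 →
      (g w).im = ∫ t, ((cayley t + w) / (cayley t - w)).re ∂(μ : Measure (OnePoint ℝ)) := by
  set r : ℕ → ℝ := fun n => 1 - 1 / ((n : ℝ) + 1)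
  have hr0 (n : ℕ) : 0 ≤ r n := by
    simp only [r, sub_nonneg]
    rw [div_le_one (by positivity)]
    linarith [n.cast_nonneg (α := ℝ)]
  have hr1 (n : ℕ) : r n < 1 := by
    simp only [r, sub_lt_self_iff]
    positivity
  have hrlim : Tendsto r atTop (𝓝 1) := by
    simpa [r] using (tendsto_one_div_add_atTop_nhds_zero_nat (𝕜 := ℝ)).const_sub 1
  choose μ hμ using fun n => exists_measure_poisson_of_differentiableOn_ball hg hpos
    (hr0 n) (hr1 n)
  have hne (t : OnePoint ℝ) : cayley t ≠ 0 := norm_ne_zero_iff.1 (by simp [norm_cayley])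
  have hmass (n : ℕ) : (μ n).mass ≤ (g 0).im.toNNReal := by
    have := hμ n 0 (by simp)
    simp only [mul_zero, add_zero, sub_zero, div_self (hne _), Complex.one_re, integral_const,
      smul_eq_mul, mul_one] at this
    rw [← NNReal.coe_le_coe, Real.coe_toNNReal _ (hpos 0 (by simp)).le]
    exact this.symm.le
  obtain ⟨μ', -, hμ'⟩ := (isCompact_setOfPred_finiteMeasure_le_of_compactSpace (OnePoint ℝ)
    (g 0).im.toNNReal).ultrafilter_le_nhds ((Ultrafilter.of atTop).map μ)
    (by
      rw [le_principal_iff]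
      exact Ultrafilter.mem_map.2 (univ_mem' hmass))
  have hμ'' : Tendsto μ (Ultrafilter.of atTop : Ultrafilter ℕ) (𝓝 μ') := hμ'
  refine ⟨μ', fun w hw => ?_⟩
  have hcont : Continuous fun t => ((cayley t + w) / (cayley t - w)).re :=
    Complex.continuous_re.comp ((continuous_cayley.add continuous_const).div
      (continuous_cayley.sub continuous_const) (cayley_sub_ne_zero hw))
  have h1 := FiniteMeasure.tendsto_iff_forall_integral_tendsto.1 hμ''
    (BoundedContinuousFunction.mkOfCompact ⟨_, hcont⟩)
  simp only [BoundedContinuousFunction.mkOfCompact_apply, ContinuousMap.coe_mk, ← hμ _ w hw] at h1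
  refine tendsto_nhds_unique (l := ((Ultrafilter.of atTop : Ultrafilter ℕ) : Filter ℕ)) ?_ h1
  have hlim : Tendsto (fun n => (r n : ℂ) * w) atTop (𝓝 w) := by
    simpa using ((Complex.continuous_ofReal.tendsto 1).comp hrlim).mul_const w
  have hca : ContinuousAt g w :=
    (hg.differentiableAt (Metric.isOpen_ball.mem_nhds (by simpa using hw))).continuousAt
  exact ((Complex.continuous_im.tendsto _).comp (hca.tendsto.comp hlim)).mono_left
    (Ultrafilter.of_le atTop)

lemma eq_of_differentiableOn_ball_of_im_eq_zero {D : ℂ → ℂ}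
    (hD : DifferentiableOn ℂ D (Metric.ball 0 1)) (him : ∀ w, ‖w‖ < 1 → (D w).im = 0)
    {w : ℂ} (hw : ‖w‖ < 1) : D w = D 0 := by
  rcases (hD.analyticOnNhd Metric.isOpen_ball).is_constant_or_isOpen
    (convex_ball 0 1).isPreconnected with ⟨c, hc⟩ | hopen
  · rw [hc w (by simpa using hw), hc 0 (by simp)]
  · exfalso
    have h := hopen _ subset_rfl Metric.isOpen_ball
    have h0 : D 0 ∈ D '' Metric.ball 0 1 := ⟨0, by simp, rfl⟩
    obtain ⟨ε, hε, hsub⟩ := Metric.isOpen_iff.1 h _ h0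
    obtain ⟨v, hv, hvD⟩ := hsub (show D 0 + (ε / 2 : ℝ) * I ∈ Metric.ball (D 0) ε by
      simp [abs_of_pos hε]; linarith)
    have h1 := congrArg Complex.im hvD
    rw [him v (by simpa using hv)] at h1
    simp [him 0 (by simp)] at h1
    linarith

theorem IsHerglotz.exists_representation {F : ℂ → ℂ} (hF : IsHerglotz F) :
    ∃ (a : ℝ) (ν : Measure (OnePoint ℝ)), IsFiniteMeasure ν ∧
      ∀ z : ℂ, 0 < z.im → F z = a + ∫ t, herglotzKernel z t ∂ν := by
  have hg : DifferentiableOn ℂ (fun w => F (invCayley w)) (Metric.ball 0 1) :=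
    hF.1.comp (fun w hw => (differentiableAt_invCayley (by simpa using hw)).differentiableWithinAt)
      fun w hw => invCayley_im_pos (by simpa using hw)
  obtain ⟨μ, hμ⟩ := exists_measure_im_eq_of_differentiableOn_ball hg fun w hw =>
    hF.2 _ (invCayley_im_pos hw)
  set D : ℂ → ℂ := fun w => F (invCayley w) - ∫ t, herglotzKernel (invCayley w) t ∂(μ : Measure _)
  have hD : DifferentiableOn ℂ D (Metric.ball 0 1) :=
    hg.sub (differentiableOn_integral_herglotzKernel_invCayley _)
  have him (w : ℂ) (hw : ‖w‖ < 1) : (D w).im = 0 := by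
    have h1 : (∫ t, herglotzKernel (invCayley w) t ∂(μ : Measure _)).im
        = ∫ t, (herglotzKernel (invCayley w) t).im ∂(μ : Measure _) :=
      (Complex.imCLM.integral_comp_comm
        (integrable_herglotzKernel _ (invCayley_im_pos hw))).symm
    simp only [D, Complex.sub_im]
    rw [h1, hμ w hw]
    simp only [herglotzKernel_invCayley hw, Complex.I_mul_im, sub_self]
  refine ⟨(D 0).re, μ, inferInstance, fun z hz => ?_⟩
  have h := eq_of_differentiableOn_ball_of_im_eq_zero hD him (norm_cayley_disc hz)
  have h0 : ((D 0).re : ℂ) = D 0 := Complex.ext rfl (by simp [him 0 (by simp)])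
  rw [h0, ← h]
  simp only [D]
  rw [invCayley_cayley_disc hz]
  ring

lemma ext_of_integral_cayley_pow {ν ν' : Measure (OnePoint ℝ)} [IsFiniteMeasure ν]
    [IsFiniteMeasure ν'] (h : ∀ n : ℕ, ∫ t, cayley t ^ n ∂ν = ∫ t, cayley t ^ n ∂ν') : ν = ν' := by
  have hmul (t : OnePoint ℝ) : cayley t * star (cayley t) = 1 := by
    have := Complex.mul_conj (cayley t)
    rw [Complex.normSq_eq_norm_sq, norm_cayley] at this
    simpa using this
  have hconj (n : ℕ) : ∫ t, star (cayley t) ^ n ∂ν = ∫ t, star (cayley t) ^ n ∂ν' := by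
    have h1 (m : Measure (OnePoint ℝ)) :
        ∫ t, star (cayley t) ^ n ∂m = (starRingEnd ℂ) (∫ t, cayley t ^ n ∂m) := by
      rw [← integral_conj]
      exact integral_congr_ae (ae_of_all _ fun t => (map_pow (starRingEnd ℂ) _ _).symm)
    rw [h1, h1, h n]
  have hmono (m n : ℕ) : ∫ t, cayley t ^ m * star (cayley t) ^ n ∂ν
      = ∫ t, cayley t ^ m * star (cayley t) ^ n ∂ν' := by
    rcases le_total m n with hmn | hmn
    · obtain ⟨k, rfl⟩ := Nat.exists_eq_add_of_le hmn
      simp_rw [pow_add, ← mul_assoc, ← mul_pow, hmul, one_pow, one_mul]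
      exact hconj k
    · obtain ⟨k, rfl⟩ := Nat.exists_eq_add_of_le hmn
      have h2 (t : OnePoint ℝ) : cayley t ^ (n + k) * star (cayley t) ^ n = cayley t ^ k := by
        rw [pow_add, mul_right_comm, ← mul_pow, hmul, one_pow, one_mul]
      simp_rw [h2]
      exact h k
  set u : BoundedContinuousFunction (OnePoint ℝ) ℂ :=
    BoundedContinuousFunction.mkOfCompact ⟨cayley, continuous_cayley⟩
  have hu (t : OnePoint ℝ) : u t = cayley t := rfl
  refine ext_of_forall_mem_subalgebra_integral_eq_of_polish (𝕜 := ℂ)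
    (A := StarAlgebra.adjoin ℂ {u}) ?_ fun g hg => ?_
  · intro t t' htt'
    refine ⟨cayley, ⟨u.toContinuousMap, ⟨u, StarAlgebra.self_mem_adjoin_singleton ℂ u, rfl⟩, rfl⟩,
      cayley_injective.ne htt'⟩
  · have hg' : g ∈ Submodule.span ℂ
        (Submonoid.closure ({u, star u} : Set (BoundedContinuousFunction (OnePoint ℝ) ℂ)) :
          Set (BoundedContinuousFunction (OnePoint ℝ) ℂ)) := by
      rw [← Algebra.adjoin_eq_span]
      have : g ∈ (StarAlgebra.adjoin ℂ {u}).toSubalgebra := hg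
      rw [StarAlgebra.adjoin_toSubalgebra] at this
      rwa [Set.star_singleton, Set.singleton_union] at this
    clear hg
    have hint (f : BoundedContinuousFunction (OnePoint ℝ) ℂ) (m : Measure (OnePoint ℝ))
        [IsFiniteMeasure m] : Integrable f m := integrable_of_continuous_onePoint f.continuous
    induction hg' using Submodule.span_induction with
    | mem f hf =>
      obtain ⟨m, n, rfl⟩ := (Submonoid.mem_closure_pair u (star u) f).1 hf
      exact hmono m n
    | zero => simp
    | add f f' _ _ hf hf' =>
      simp only [BoundedContinuousFunction.coe_add, Pi.add_apply]
      rw [integral_add (hint f ν) (hint f' ν), integral_add (hint f ν') (hint f' ν'), hf, hf']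
    | smul c f _ hf =>
      simp only [BoundedContinuousFunction.coe_smul]
      rw [integral_smul, integral_smul, hf]

theorem measure_eq_of_integral_herglotzKernel_eq {ν ν' : Measure (OnePoint ℝ)} [IsFiniteMeasure ν]
    [IsFiniteMeasure ν'] {a a' : ℝ} (h : ∀ z : ℂ, 0 < z.im →
      a + ∫ t, herglotzKernel z t ∂ν = a' + ∫ t, herglotzKernel z t ∂ν') : ν = ν' := by
  have hne (t : OnePoint ℝ) : cayley t ≠ 0 := norm_ne_zero_iff.1 (by simp [norm_cayley])
  have hw {w : ℂ} (hw : ‖w‖ < 1) := h _ (invCayley_im_pos hw)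
  have h0 := hw (w := 0) (by simp)
  rw [integral_herglotzKernel_invCayley ν (by simp), integral_herglotzKernel_invCayley ν' (by simp)]
    at h0
  simp only [sub_zero, div_self (hne _), integral_const, Complex.real_smul, mul_one] at h0
  have hre := congrArg Complex.re h0
  have him := congrArg Complex.im h0
  simp at hre him
  have hmass : ν.real Set.univ = ν'.real Set.univ := by linarith
  have hG {w : ℂ} (hw1 : ‖w‖ < 1) :
      ∫ t, cayley t / (cayley t - w) ∂ν = ∫ t, cayley t / (cayley t - w) ∂ν' := by
    have := hw hw1
    rw [integral_herglotzKernel_invCayley ν hw1, integral_herglotzKernel_invCayley ν' hw1, hre,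
      hmass] at this
    have h2 := mul_left_cancel₀ Complex.I_ne_zero (add_left_cancel this)
    exact mul_left_cancel₀ two_ne_zero (sub_left_inj.1 h2)
  have hser := (hasFPowerSeriesOnBall_integral_cayley ν).hasFPowerSeriesAt
    |>.eq_formalMultilinearSeries_of_eventually
      (hasFPowerSeriesOnBall_integral_cayley ν').hasFPowerSeriesAt (by
        filter_upwards [Metric.ball_mem_nhds (0 : ℂ) one_pos] with w hw1
        exact hG (by simpa using hw1))
  rw [FormalMultilinearSeries.ofScalars_series_eq_iff] at hser
  refine ext_of_integral_cayley_pow fun n => ?_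
  have hstar (m : Measure (OnePoint ℝ)) :
      ∫ t, cayley t ^ n ∂m = (starRingEnd ℂ) (∫ t, (cayley t)⁻¹ ^ n ∂m) := by
    rw [← integral_conj]
    refine integral_congr_ae (ae_of_all _ fun t => ?_)
    simp only [map_pow]
    congr 1
    rw [Complex.inv_def, Complex.normSq_eq_norm_sq, norm_cayley]
    simp
  rw [hstar, hstar, congrFun hser n]

lemma integrableOn_and_integral_layer {a : ℝ} (ha : 0 ≤ a) :
    IntegrableOn (fun ρ : ℝ => 2 * ρ / (1 + ρ ^ 2) ^ 2) (Set.Ioi a) ∧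
      ∫ ρ in Set.Ioi a, 2 * ρ / (1 + ρ ^ 2) ^ 2 = 1 / (1 + a ^ 2) := by
  have hd (x : ℝ) : HasDerivAt (fun ρ : ℝ => -(1 + ρ ^ 2)⁻¹) (2 * x / (1 + x ^ 2) ^ 2) x := by
    have h1 : HasDerivAt (fun ρ : ℝ => 1 + ρ ^ 2) (2 * x) x := by
      simpa using (hasDerivAt_pow 2 x).const_add 1
    have := (h1.inv (by positivity)).neg
    rwa [neg_div, neg_neg] at this
  have hlim : Tendsto (fun ρ : ℝ => -(1 + ρ ^ 2)⁻¹) atTop (𝓝 0) := by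
    have : Tendsto (fun ρ : ℝ => 1 + ρ ^ 2) atTop atTop :=
      tendsto_atTop_add_const_left _ _ (tendsto_pow_atTop two_ne_zero)
    simpa using this.inv_tendsto_atTop.neg
  have hint := integrableOn_Ioi_deriv_of_nonneg' (a := a) (fun x _ => hd x)
    (fun x hx => by
      have : 0 ≤ x := ha.trans (le_of_lt hx)
      positivity) hlim
  refine ⟨hint, ?_⟩
  rw [integral_Ioi_of_hasDerivAt_of_tendsto' (fun x _ => hd x) hint hlim]
  simp

/-- The layer cake decomposition of the Poisson kernel. -/
lemma poisson_eq_integral_layer {y : ℝ} (hy : 0 < y) (u : ℝ) :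
    y / (u ^ 2 + y ^ 2) = y⁻¹ * ∫ ρ in Set.Ici (0 : ℝ),
      {ρ : ℝ | |u| ≤ y * ρ}.indicator (fun ρ => 2 * ρ / (1 + ρ ^ 2) ^ 2) ρ := by
  have hset : {ρ : ℝ | |u| ≤ y * ρ} = Set.Ici (|u| / y) := by
    ext ρ
    simp [div_le_iff₀ hy, mul_comm]
  have ha : 0 ≤ |u| / y := by positivity
  rw [hset, setIntegral_indicator measurableSet_Ici, Set.Ici_inter_Ici, sup_of_le_right ha,
    integral_Ici_eq_integral_Ioi, (integrableOn_and_integral_layer ha).2, div_pow, sq_abs]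
  field_simp
  ring

lemma integral_poisson_eq_integral_closedBall (N : Measure ℝ) [IsFiniteMeasure N] (t : ℝ) {y : ℝ}
    (hy : 0 < y) :
    ∫ s, y / ((s - t) ^ 2 + y ^ 2) ∂N = ∫ ρ in Set.Ioi (0 : ℝ),
      N.real (Metric.closedBall t (y * ρ)) / (2 * (y * ρ)) * (4 * ρ ^ 2 / (1 + ρ ^ 2) ^ 2) := by
  have hk : Integrable (fun ρ : ℝ => 2 * ρ / (1 + ρ ^ 2) ^ 2) (volume.restrict (Set.Ici 0)) :=
    (integrableOn_Ici_iff_integrableOn_Ioi (by simp)).2 (integrableOn_and_integral_layer le_rfl).1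
  have hmeas : MeasurableSet {p : ℝ × ℝ | |p.1 - t| ≤ y * p.2} :=
    measurableSet_le (by fun_prop) (by fun_prop)
  have hint : Integrable (Function.uncurry fun s ρ : ℝ =>
      {ρ : ℝ | |s - t| ≤ y * ρ}.indicator (fun ρ => 2 * ρ / (1 + ρ ^ 2) ^ 2) ρ)
      (N.prod (volume.restrict (Set.Ici 0))) :=
    (hk.comp_snd N).indicator hmeas
  simp_rw [poisson_eq_integral_layer hy]
  rw [integral_const_mul, integral_integral_swap hint, integral_Ici_eq_integral_Ioi,
    ← integral_const_mul]
  refine setIntegral_congr_fun measurableSet_Ioi fun ρ (hρ : 0 < ρ) => ?_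
  have : (fun s : ℝ => {ρ : ℝ | |s - t| ≤ y * ρ}.indicator (fun ρ => 2 * ρ / (1 + ρ ^ 2) ^ 2) ρ) =
      (Metric.closedBall t (y * ρ)).indicator fun _ => 2 * ρ / (1 + ρ ^ 2) ^ 2 := by
    ext s
    simp [Set.indicator, Real.dist_eq]
  simp only [this]
  rw [integral_indicator_const _ measurableSet_closedBall, smul_eq_mul]
  field_simp
  ring

lemma integrableOn_layer_moment :
    IntegrableOn (fun ρ : ℝ => 4 * ρ ^ 2 / (1 + ρ ^ 2) ^ 2) (Set.Ioi 0) := by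
  refine ((integrable_inv_one_add_sq.const_mul 4).integrableOn).mono'
    (Measurable.aestronglyMeasurable (by fun_prop)) (ae_of_all _ fun ρ => ?_)
  rw [Real.norm_of_nonneg (by positivity), ← div_eq_mul_inv, div_le_div_iff₀ (by positivity)
    (by positivity)]
  nlinarith [sq_nonneg ρ, sq_nonneg (ρ ^ 2)]

/-- The constant by which the Poisson integral recovers the density (its value is `π`). -/
noncomputable def fatouConst : ℝ := ∫ ρ in Set.Ioi (0 : ℝ), 4 * ρ ^ 2 / (1 + ρ ^ 2) ^ 2

lemma fatouConst_pos : 0 < fatouConst := by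
  refine (setIntegral_pos_iff_support_of_nonneg_ae (ae_of_all _ fun ρ => ?_)
    integrableOn_layer_moment).2 ?_
  · simp only [Pi.zero_apply]
    positivity
  · have : Set.Ioi (0 : ℝ) ⊆ Function.support (fun ρ : ℝ => 4 * ρ ^ 2 / (1 + ρ ^ 2) ^ 2) ∩
        Set.Ioi 0 := fun ρ (hρ : 0 < ρ) => ⟨(by positivity : 4 * ρ ^ 2 / (1 + ρ ^ 2) ^ 2 ≠ 0), hρ⟩
    refine lt_of_lt_of_le ?_ (measure_mono this)
    simp

lemma tendsto_integral_poisson_of_tendsto (N : Measure ℝ) [IsFiniteMeasure N] {t D : ℝ}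
    (h : Tendsto (fun r => N.real (Metric.closedBall t r) / (2 * r)) (𝓝[>] 0) (𝓝 D)) :
    Tendsto (fun y : ℝ => ∫ s, y / ((s - t) ^ 2 + y ^ 2) ∂N) (𝓝[>] 0) (𝓝 (fatouConst * D)) := by
  have hbound : ∃ M, ∀ r, 0 < r → N.real (Metric.closedBall t r) / (2 * r) ≤ M := by
    have h1 : ∀ᶠ r in 𝓝[>] (0 : ℝ), N.real (Metric.closedBall t r) / (2 * r) < D + 1 :=
      h.eventually_lt_const (by linarith)
    obtain ⟨δ, hδ, hr⟩ := mem_nhdsGT_iff_exists_Ioo_subset.1 h1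
    have hδ : 0 < δ := hδ
    refine ⟨max (D + 1) (N.real Set.univ / (2 * δ)), fun r hr0 => ?_⟩
    rcases lt_or_ge r δ with hlt | hge
    · exact (le_of_lt (hr ⟨hr0, hlt⟩)).trans (le_max_left _ _)
    · refine le_trans ?_ (le_max_right _ _)
      gcongr ?_ / (2 * ?_)
      exact measureReal_mono (μ := N) (Set.subset_univ _)
  obtain ⟨M, hM⟩ := hbound
  have hmono : Monotone fun r : ℝ => N.real (Metric.closedBall t r) :=
    fun r r' hrr' => measureReal_mono (Metric.closedBall_subset_closedBall hrr')
  have key : Tendsto (fun y : ℝ => ∫ ρ in Set.Ioi (0 : ℝ),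
      N.real (Metric.closedBall t (y * ρ)) / (2 * (y * ρ)) * (4 * ρ ^ 2 / (1 + ρ ^ 2) ^ 2))
      (𝓝[>] 0) (𝓝 (∫ ρ in Set.Ioi (0 : ℝ), D * (4 * ρ ^ 2 / (1 + ρ ^ 2) ^ 2))) := by
    refine tendsto_integral_filter_of_dominated_convergence
      (fun ρ => M * (4 * ρ ^ 2 / (1 + ρ ^ 2) ^ 2)) ?_ ?_
      (integrableOn_layer_moment.const_mul M) ?_
    · refine Eventually.of_forall fun y => Measurable.aestronglyMeasurable ?_
      exact ((hmono.measurable.comp (measurable_const_mul y)).div (by fun_prop)).mul (by fun_prop)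
    · filter_upwards [self_mem_nhdsWithin] with y (hy : 0 < y)
      filter_upwards [ae_restrict_mem measurableSet_Ioi] with ρ (hρ : 0 < ρ)
      rw [Real.norm_of_nonneg (by positivity)]
      gcongr
      exact hM _ (by positivity)
    · filter_upwards [ae_restrict_mem measurableSet_Ioi] with ρ (hρ : 0 < ρ)
      refine Tendsto.mul_const _ (h.comp (tendsto_nhdsWithin_iff.2 ⟨?_, ?_⟩))
      · refine Tendsto.mono_left ?_ nhdsWithin_le_nhds
        simpa using (continuous_id.mul continuous_const).tendsto (0 : ℝ) (f := fun y => id y * ρ)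
      · filter_upwards [self_mem_nhdsWithin] with y (hy : 0 < y)
        exact mul_pos hy hρ
  rw [integral_const_mul, mul_comm] at key
  refine key.congr' ?_
  filter_upwards [self_mem_nhdsWithin] with y hy
  exact (integral_poisson_eq_integral_closedBall N t hy).symm

lemma ae_tendsto_integral_poisson (N : Measure ℝ) [IsFiniteMeasure N] :
    ∀ᵐ t : ℝ, Tendsto (fun y : ℝ => ∫ s, y / ((s - t) ^ 2 + y ^ 2) ∂N) (𝓝[>] 0)
      (𝓝 (fatouConst * (N.rnDeriv volume t).toReal)) := by
  filter_upwards [Besicovitch.ae_tendsto_rnDeriv N volume, N.rnDeriv_lt_top volume] with t ht hlt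
  refine tendsto_integral_poisson_of_tendsto N ?_
  refine ((ENNReal.tendsto_toReal hlt.ne).comp ht).congr' ?_
  filter_upwards [self_mem_nhdsWithin] with r (hr : 0 < r)
  simp [Real.volume_closedBall, Measure.real, ENNReal.toReal_div, ENNReal.toReal_ofReal,
    hr.le]

lemma measurableEmbedding_onePoint_coe : MeasurableEmbedding ((↑) : ℝ → OnePoint ℝ) :=
  OnePoint.isOpenEmbedding_coe.measurableEmbedding

/-- The restriction to `ℝ` of a measure on `OnePoint ℝ`. -/
noncomputable def finitePart (ν : Measure (OnePoint ℝ)) : Measure ℝ :=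
  ν.comap ((↑) : ℝ → OnePoint ℝ)

instance (ν : Measure (OnePoint ℝ)) [IsFiniteMeasure ν] : IsFiniteMeasure (finitePart ν) := by
  unfold finitePart
  infer_instance

lemma finitePart_apply (ν : Measure (OnePoint ℝ)) (s : Set ℝ) :
    finitePart ν s = ν (((↑) : ℝ → OnePoint ℝ) '' s) :=
  measurableEmbedding_onePoint_coe.comap_apply ν s

lemma herglotzKernel_coe_im {z : ℂ} (hz : 0 < z.im) (s : ℝ) :
    (herglotzKernel z (s : OnePoint ℝ)).im =
      z.im * (1 + s ^ 2) / ((s - z.re) ^ 2 + z.im ^ 2) := by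
  have hne : (s - z.re) ^ 2 + z.im ^ 2 ≠ 0 := by positivity
  have hns : normSq ((s : ℂ) - z) = (s - z.re) ^ 2 + z.im ^ 2 := by
    simp [normSq_apply]
    ring
  rw [herglotzKernel_coe, div_im, hns]
  simp
  field_simp
  ring

lemma herglotzKernel_im_pos {z : ℂ} (hz : 0 < z.im) (x : OnePoint ℝ) :
    0 < (herglotzKernel z x).im := by
  induction x using OnePoint.rec with
  | infty => exact hz
  | coe s =>
    rw [herglotzKernel_coe_im hz]
    positivity

lemma integrable_herglotzKernel_im (ν : Measure (OnePoint ℝ)) [IsFiniteMeasure ν] {z : ℂ}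
    (hz : 0 < z.im) : Integrable (fun x => (herglotzKernel z x).im) ν :=
  (integrable_herglotzKernel ν hz).im

lemma im_integral_herglotzKernel (ν : Measure (OnePoint ℝ)) [IsFiniteMeasure ν] {z : ℂ}
    (hz : 0 < z.im) : (∫ x, herglotzKernel z x ∂ν).im = ∫ x, (herglotzKernel z x).im ∂ν :=
  (integral_im (integrable_herglotzKernel ν hz)).symm

/-- The Poisson kernel on `ℝ`, extended by `0` at infinity. -/
noncomputable def poissonExtend (t y : ℝ) : OnePoint ℝ → ℝ :=
  Function.extend (↑) (fun s : ℝ => y / ((s - t) ^ 2 + y ^ 2)) 0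

lemma poissonExtend_coe (t y s : ℝ) :
    poissonExtend t y (s : OnePoint ℝ) = y / ((s - t) ^ 2 + y ^ 2) :=
  OnePoint.coe_injective.extend_apply _ _ _

lemma poissonExtend_infty (t y : ℝ) : poissonExtend t y OnePoint.infty = 0 :=
  Function.extend_apply' _ _ _ (by rintro ⟨s, hs⟩; exact OnePoint.coe_ne_infty s hs)

lemma integrable_poissonExtend (ν : Measure (OnePoint ℝ)) [IsFiniteMeasure ν] (t : ℝ) {y : ℝ}
    (hy : 0 < y) : Integrable (poissonExtend t y) ν := by
  refine Integrable.of_bound (C := 1 / y) (Measurable.aestronglyMeasurable ?_)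
    (ae_of_all _ fun x => ?_)
  · exact measurableEmbedding_onePoint_coe.measurable_extend (by fun_prop) measurable_const
  · induction x using OnePoint.rec with
    | infty =>
      rw [poissonExtend_infty, norm_zero]
      positivity
    | coe s =>
      rw [poissonExtend_coe, Real.norm_of_nonneg (by positivity),
        div_le_div_iff₀ (by positivity) hy]
      nlinarith [sq_nonneg (s - t)]

lemma integral_poissonExtend (ν : Measure (OnePoint ℝ)) (t y : ℝ) :
    ∫ x, poissonExtend t y x ∂ν = ∫ s, y / ((s - t) ^ 2 + y ^ 2) ∂(finitePart ν) := by
  rw [← setIntegral_eq_integral_of_forall_compl_eq_zero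
    (s := Set.range ((↑) : ℝ → OnePoint ℝ)), ← measurableEmbedding_onePoint_coe.map_comap,
    measurableEmbedding_onePoint_coe.integral_map]
  · simp_rw [poissonExtend_coe]
    rfl
  · intro x hx
    exact Function.extend_apply' _ _ _ hx

lemma abs_herglotzKernel_im_sub_poissonExtend_le (t : ℝ) {y : ℝ} (hy : 0 < y) (hy1 : y ≤ 1)
    (x : OnePoint ℝ) :
    |(herglotzKernel (t + y * I) x).im - (1 + t ^ 2) * poissonExtend t y x| ≤ 1 + |t| := by
  induction x using OnePoint.rec with
  | infty =>
    simp only [herglotzKernel_infty, poissonExtend_infty]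
    simp [abs_of_pos hy]
    linarith [abs_nonneg t]
  | coe s =>
    rw [poissonExtend_coe, herglotzKernel_coe_im (by simpa using hy)]
    simp only [add_re, ofReal_re, mul_re, I_re, mul_zero, ofReal_im, I_im, mul_one, sub_self,
      add_zero, add_im, mul_im, zero_add]
    have hpos : 0 < (s - t) ^ 2 + y ^ 2 := by positivity
    rw [show y * (1 + s ^ 2) / ((s - t) ^ 2 + y ^ 2) - (1 + t ^ 2) * (y / ((s - t) ^ 2 + y ^ 2))
      = (y * (s - t) ^ 2 + 2 * t * (y * (s - t))) / ((s - t) ^ 2 + y ^ 2) by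
        field_simp; ring, abs_div, abs_of_pos hpos, div_le_iff₀ hpos]
    refine (abs_add_le _ _).trans ?_
    rw [abs_of_nonneg (by positivity : 0 ≤ y * (s - t) ^ 2), add_mul, abs_mul, abs_mul]
    refine add_le_add ?_ ?_
    · nlinarith [sq_nonneg (s - t), sq_nonneg y]
    · have : 2 * |y * (s - t)| ≤ (s - t) ^ 2 + y ^ 2 := by
        rw [abs_mul, ← sq_abs y, ← sq_abs (s - t)]
        nlinarith [sq_nonneg (|y| - |s - t|)]
      rw [abs_two]
      nlinarith [abs_nonneg t]

lemma tendsto_herglotzKernel_im_sub_poissonExtend (t : ℝ) (x : OnePoint ℝ) :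
    Tendsto (fun y : ℝ => (herglotzKernel (t + y * I) x).im - (1 + t ^ 2) * poissonExtend t y x)
      (𝓝[>] 0) (𝓝 0) := by
  induction x using OnePoint.rec with
  | infty =>
    simp only [herglotzKernel_infty, poissonExtend_infty]
    have h : Tendsto (fun y : ℝ => y) (𝓝[>] 0) (𝓝 0) := tendsto_id.mono_left nhdsWithin_le_nhds
    simpa using h
  | coe s =>
    have h : Tendsto (fun y : ℝ => y * (s ^ 2 - t ^ 2) / ((s - t) ^ 2 + y ^ 2))
        (𝓝[>] 0) (𝓝 0) := by
      rcases eq_or_ne s t with rfl | hst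
      · simp
      · have h0 : (s - t) ^ 2 + (0 : ℝ) ^ 2 ≠ 0 := by
          have := sub_ne_zero.2 hst
          positivity
        have : ContinuousAt (fun y : ℝ => y * (s ^ 2 - t ^ 2) / ((s - t) ^ 2 + y ^ 2)) 0 :=
          ContinuousAt.div (by fun_prop) (by fun_prop) h0
        simpa using this.tendsto.mono_left nhdsWithin_le_nhds
    refine h.congr' ?_
    filter_upwards [self_mem_nhdsWithin] with y (hy : 0 < y)
    rw [poissonExtend_coe, herglotzKernel_coe_im (by simpa using hy)]
    simp only [add_re, ofReal_re, mul_re, I_re, mul_zero, ofReal_im, I_im, mul_one, sub_self,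
      add_zero, add_im, mul_im, zero_add]
    field_simp
    ring

/-- Fatou's theorem for the imaginary part of a Herglotz integral. -/
theorem ae_tendsto_im_integral_herglotzKernel (ν : Measure (OnePoint ℝ)) [IsFiniteMeasure ν] :
    ∀ᵐ t : ℝ, Tendsto (fun y : ℝ => (∫ x, herglotzKernel (t + y * I) x ∂ν).im) (𝓝[>] 0)
      (𝓝 ((1 + t ^ 2) * (fatouConst * ((finitePart ν).rnDeriv volume t).toReal))) := by
  filter_upwards [ae_tendsto_integral_poisson (finitePart ν)] with t ht
  have him {y : ℝ} (hy : 0 < y) : 0 < ((t : ℂ) + y * I).im := by simpa using hy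
  have hrest : Tendsto (fun y : ℝ => ∫ x, ((herglotzKernel (t + y * I) x).im -
      (1 + t ^ 2) * poissonExtend t y x) ∂ν) (𝓝[>] 0) (𝓝 (∫ _, (0 : ℝ) ∂ν)) := by
    refine tendsto_integral_filter_of_dominated_convergence (fun _ => 1 + |t|) ?_ ?_
      (integrable_const _) (ae_of_all _ (tendsto_herglotzKernel_im_sub_poissonExtend t))
    · filter_upwards [self_mem_nhdsWithin] with y hy
      exact ((integrable_herglotzKernel_im ν (him hy)).sub
        ((integrable_poissonExtend ν t hy).const_mul _)).aestronglyMeasurable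
    · filter_upwards [Ioo_mem_nhdsGT one_pos] with y hy
      exact ae_of_all _ (abs_herglotzKernel_im_sub_poissonExtend_le t hy.1 hy.2.le)
  have := (ht.const_mul (1 + t ^ 2)).add hrest
  simp only [integral_zero, add_zero] at this
  refine this.congr' ?_
  filter_upwards [self_mem_nhdsWithin] with y hy
  rw [integral_sub (integrable_herglotzKernel_im ν (him hy))
    ((integrable_poissonExtend ν t hy).const_mul _), integral_const_mul, integral_poissonExtend,
    add_sub_cancel, im_integral_herglotzKernel ν (him hy)]

lemma IsHerglotz.ae_tendsto_im {F : ℂ → ℂ} (hF : IsHerglotz F) :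
    ∀ᵐ t : ℝ, ∃ v : ℝ, Tendsto (fun y : ℝ => (F (t + y * I)).im) (𝓝[>] 0) (𝓝 v) := by
  obtain ⟨a, ν, hν, hrep⟩ := hF.exists_representation
  filter_upwards [ae_tendsto_im_integral_herglotzKernel ν] with t ht
  refine ⟨_, ht.congr' ?_⟩
  filter_upwards [self_mem_nhdsWithin] with y hy
  rw [hrep _ (by simpa using hy)]
  simp

lemma exp_half_log_im_pos_re_pos {w : ℂ} (hw : 0 < w.im) :
    0 < (exp (log w / 2)).im ∧ 0 < (exp (log w / 2)).re := by
  have h0 : 0 < w.arg :=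
    lt_of_le_of_ne (arg_nonneg_iff.2 hw.le) fun h => hw.ne' (arg_eq_zero_iff.1 h.symm).2
  have hpi : w.arg ≤ Real.pi := arg_le_pi w
  have hpi' : w.arg ≠ Real.pi := fun h => hw.ne' (arg_eq_pi_iff.1 h).2
  have hpi'' := lt_of_le_of_ne hpi hpi'
  have him : (log w / 2).im = w.arg / 2 := by
    rw [show (2 : ℂ) = ((2 : ℝ) : ℂ) by simp, div_ofReal_im, log_im]
  rw [exp_im, exp_re, him]
  exact ⟨mul_pos (Real.exp_pos _) (Real.sin_pos_of_pos_of_lt_pi (by linarith) (by linarith)),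
    mul_pos (Real.exp_pos _) (Real.cos_pos_of_mem_Ioo ⟨by linarith, by linarith⟩)⟩

/-- The boundary values of a Herglotz function exist almost everywhere: apply Fatou's theorem to
the imaginary parts of `√F` and `i√F`. -/
theorem IsHerglotz.ae_tendsto {F : ℂ → ℂ} (hF : IsHerglotz F) :
    ∀ᵐ t : ℝ, ∃ w : ℂ, Tendsto (fun y : ℝ => F (t + y * I)) (𝓝[>] 0) (𝓝 w) := by
  have hdiff : DifferentiableOn ℂ (fun z => exp (log (F z) / 2)) {z | 0 < z.im} :=
    ((hF.1.clog fun z hz => Or.inr (hF.2 z hz).ne').div_const 2).cexp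
  have hS : IsHerglotz fun z => exp (log (F z) / 2) :=
    ⟨hdiff, fun z hz => (exp_half_log_im_pos_re_pos (hF.2 z hz)).1⟩
  have hIS : IsHerglotz fun z => I * exp (log (F z) / 2) := by
    refine ⟨hdiff.const_mul I, fun z hz => ?_⟩
    rw [I_mul_im]
    exact (exp_half_log_im_pos_re_pos (hF.2 z hz)).2
  filter_upwards [hS.ae_tendsto_im, hIS.ae_tendsto_im] with t ⟨v, hv⟩ ⟨u, hu⟩
  simp only [I_mul_im] at hu
  have hlim := ((continuous_ofReal.tendsto u).comp hu).add
    (((continuous_ofReal.tendsto v).comp hv).mul_const I)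
  refine ⟨_, (hlim.pow 2).congr' ?_⟩
  filter_upwards [self_mem_nhdsWithin] with y hy
  have hne : F (t + y * I) ≠ 0 := fun h => by
    have := hF.2 (t + y * I) (by simpa using hy)
    simp [h] at this
  simp only [Function.comp_apply, re_add_im]
  rw [← exp_nat_mul, Nat.cast_ofNat, mul_div_cancel₀ _ two_ne_zero, exp_log hne]

lemma IsHerglotz.neg_inv {F : ℂ → ℂ} (hF : IsHerglotz F) : IsHerglotz fun z => -(F z)⁻¹ := by
  have hne (z : ℂ) (hz : 0 < z.im) : F z ≠ 0 := fun h => by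
    have := hF.2 z hz
    simp [h] at this
  refine ⟨(hF.1.inv hne).neg, fun z hz => ?_⟩
  rw [neg_im, inv_im, neg_div, neg_neg]
  exact div_pos (hF.2 z hz) (normSq_pos.2 (hne z hz))

lemma IsHerglotz.ae_not_tendsto_zero {F : ℂ → ℂ} (hF : IsHerglotz F) :
    ∀ᵐ t : ℝ, ¬ Tendsto (fun y : ℝ => F (t + y * I)) (𝓝[>] 0) (𝓝 0) := by
  filter_upwards [hF.neg_inv.ae_tendsto] with t ⟨w, hw⟩ h0
  have h := h0.mul hw
  rw [zero_mul] at h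
  have h1 : Tendsto (fun _ : ℝ => (-1 : ℂ)) (𝓝[>] 0) (𝓝 0) := by
    refine h.congr' ?_
    filter_upwards [self_mem_nhdsWithin] with y hy
    have hne : F (t + y * I) ≠ 0 := fun h => by
      have := hF.2 (t + y * I) (by simpa using hy)
      simp [h] at this
    rw [mul_neg, mul_inv_cancel₀ hne]
  have := tendsto_nhds_unique h1 tendsto_const_nhds
  norm_num at this

lemma map_restrict_finitePart (ν : Measure (OnePoint ℝ)) (s : Set ℝ) :
    ((finitePart ν).restrict s).map ((↑) : ℝ → OnePoint ℝ) =
      ν.restrict (((↑) : ℝ → OnePoint ℝ) '' s) := by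
  have h := measurableEmbedding_onePoint_coe.restrict_map (finitePart ν)
    (((↑) : ℝ → OnePoint ℝ) '' s)
  rw [Set.preimage_image_eq _ OnePoint.coe_injective, finitePart,
    measurableEmbedding_onePoint_coe.map_comap] at h
  rw [finitePart, ← h, Measure.restrict_restrict_of_subset (Set.image_subset_range _ _)]

lemma finitePart_withDensity (ν : Measure (OnePoint ℝ)) (φ : OnePoint ℝ → ENNReal) :
    finitePart (ν.withDensity φ) = (finitePart ν).withDensity fun t => φ t := by
  ext s hs
  rw [finitePart_apply,
    withDensity_apply _ (measurableEmbedding_onePoint_coe.measurableSet_image' hs),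
    withDensity_apply _ hs, ← map_restrict_finitePart,
    measurableEmbedding_onePoint_coe.lintegral_map]

/-- Two finite measures whose Lebesgue densities agree on `A` agree on `A` up to a Lebesgue null
set. -/
lemma exists_null_restrict_diff_eq {N₁ N₂ : Measure ℝ} [IsFiniteMeasure N₁] [IsFiniteMeasure N₂]
    {A : Set ℝ} (hA : MeasurableSet A)
    (h : ∀ᵐ t ∂(volume.restrict A), N₁.rnDeriv volume t = N₂.rnDeriv volume t) :
    ∃ S : Set ℝ, MeasurableSet S ∧ volume S = 0 ∧ N₁.restrict (A \ S) = N₂.restrict (A \ S) := by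
  have h₁ := Measure.mutuallySingular_singularPart N₁ volume
  have h₂ := Measure.mutuallySingular_singularPart N₂ volume
  refine ⟨h₁.nullSetᶜ ∪ h₂.nullSetᶜ,
    h₁.measurableSet_nullSet.compl.union h₂.measurableSet_nullSet.compl,
    measure_union_null h₁.measure_compl_nullSet h₂.measure_compl_nullSet, ?_⟩
  set D := A \ (h₁.nullSetᶜ ∪ h₂.nullSetᶜ) with hD
  have hDm : MeasurableSet D :=
    hA.diff (h₁.measurableSet_nullSet.compl.union h₂.measurableSet_nullSet.compl)
  have hsing {N : Measure ℝ} [IsFiniteMeasure N] {T : Set ℝ} (hT : N.singularPart volume T = 0)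
      (hDT : D ⊆ T) : N.restrict D = (volume.restrict D).withDensity (N.rnDeriv volume) := by
    conv_lhs => rw [← Measure.singularPart_add_rnDeriv N volume]
    rw [Measure.restrict_add, Measure.restrict_eq_zero.2 (measure_mono_null hDT hT), zero_add,
      restrict_withDensity hDm]
  rw [hsing h₁.measure_nullSet fun t ht => by by_contra hn; exact ht.2 (Or.inl hn),
    hsing h₂.measure_nullSet fun t ht => by by_contra hn; exact ht.2 (Or.inr hn)]
  exact withDensity_congr_ae (ae_restrict_of_ae_restrict_of_subset Set.sdiff_subset h)

/-- If `ν₁` and `ν₂` agree on `B` then `ν₁` has a density in `[0, 1]` with respect to `ν₁ + ν₂`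
which equals `1 / 2` on `B`. -/
lemma exists_density_eq_half {X : Type*} [MeasurableSpace X] {ν₁ ν₂ : Measure X}
    [IsFiniteMeasure ν₁] [IsFiniteMeasure ν₂] {B : Set X} (hB : MeasurableSet B)
    (h : ν₁.restrict B = ν₂.restrict B) :
    ∃ f : X → ℝ, Measurable f ∧ (∀ x, f x ∈ Set.Icc (0 : ℝ) 1) ∧ (∀ x ∈ B, f x = 1 / 2) ∧
      ν₁ = (ν₁ + ν₂).withDensity fun x => ENNReal.ofReal (f x) := by
  classical
  set ν := ν₁ + ν₂ with hν
  have hle : ν₁ ≤ ν := Measure.le_add_right le_rfl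
  set f : X → ℝ := B.piecewise (fun _ => 1 / 2) fun x => min 1 (ν₁.rnDeriv ν x).toReal with hf
  have hfB (x : X) (hx : x ∈ B) : f x = 1 / 2 := Set.piecewise_eq_of_mem _ _ _ hx
  refine ⟨f, ?_, fun x => ?_, hfB, ?_⟩
  · exact Measurable.piecewise hB measurable_const
      (measurable_const.min (Measure.measurable_rnDeriv _ _).ennreal_toReal)
  · by_cases hx : x ∈ B
    · rw [hfB x hx]
      norm_num
    · rw [hf, Set.piecewise_eq_of_notMem _ _ _ hx]
      exact ⟨le_min zero_le_one ENNReal.toReal_nonneg, min_le_left _ _⟩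
  · have hBeq : (ν.restrict B).withDensity (fun x => ENNReal.ofReal (f x)) = ν₁.restrict B := by
      have : (fun x => ENNReal.ofReal (f x)) =ᵐ[ν.restrict B] fun _ => 2⁻¹ := by
        filter_upwards [ae_restrict_mem hB] with x hx
        rw [hfB x hx, one_div, ENNReal.ofReal_inv_of_pos two_pos, ENNReal.ofReal_ofNat]
      rw [withDensity_congr_ae this, withDensity_const, hν, Measure.restrict_add, ← h, ← two_smul
        ENNReal (ν₁.restrict B), smul_smul, ENNReal.inv_mul_cancel two_ne_zero
        ENNReal.ofNat_ne_top, one_smul]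
    have hBc : (ν.restrict Bᶜ).withDensity (fun x => ENNReal.ofReal (f x)) = ν₁.restrict Bᶜ := by
      have : (fun x => ENNReal.ofReal (f x)) =ᵐ[ν.restrict Bᶜ] ν₁.rnDeriv ν := by
        filter_upwards [ae_restrict_mem hB.compl,
          ae_restrict_of_ae (Measure.rnDeriv_le_one_of_le hle)] with x hx hx1
        have hx1 : ν₁.rnDeriv ν x ≤ 1 := hx1
        rw [hf, Set.piecewise_eq_of_notMem _ _ _ hx, min_eq_right,
          ENNReal.ofReal_toReal (hx1.trans_lt ENNReal.one_lt_top).ne]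
        exact ENNReal.toReal_le_of_le_ofReal zero_le_one (by simpa using hx1)
      rw [withDensity_congr_ae this, ← restrict_withDensity hB.compl,
        Measure.withDensity_rnDeriv_eq _ _ (Measure.absolutelyContinuous_of_le hle)]
    rw [← Measure.restrict_add_restrict_compl (μ := ν₁) hB, ← hBeq, ← hBc,
      ← restrict_withDensity hB, ← restrict_withDensity hB.compl,
      Measure.restrict_add_restrict_compl hB]

lemma integral_withDensity_ofReal {X : Type*} [MeasurableSpace X] (ν : Measure X) {f : X → ℝ}
    (hf : Measurable f) (hf0 : ∀ x, 0 ≤ f x) (g : X → ℂ) :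
    ∫ x, g x ∂(ν.withDensity fun x => ENNReal.ofReal (f x)) = ∫ x, f x • g x ∂ν := by
  rw [integral_withDensity_eq_integral_toReal_smul hf.ennreal_ofReal
    (ae_of_all _ fun _ => ENNReal.ofReal_lt_top)]
  simp_rw [ENNReal.toReal_ofReal (hf0 _)]

lemma ae_rnDeriv_toReal_eq_of_tendsto {F : ℂ → ℂ} {a : ℝ} {ν : Measure (OnePoint ℝ)}
    [IsFiniteMeasure ν] (hrep : ∀ z : ℂ, 0 < z.im → F z = a + ∫ t, herglotzKernel z t ∂ν) :
    ∀ᵐ t : ℝ, ∀ w : ℂ, Tendsto (fun y : ℝ => F (t + y * I)) (𝓝[>] 0) (𝓝 w) →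
      w.im = (1 + t ^ 2) * (fatouConst * ((finitePart ν).rnDeriv volume t).toReal) := by
  filter_upwards [ae_tendsto_im_integral_herglotzKernel ν] with t ht w hw
  refine tendsto_nhds_unique ((continuous_im.tendsto w).comp hw) (ht.congr' ?_)
  filter_upwards [self_mem_nhdsWithin] with y hy
  simp [hrep (t + y * I) (by simpa using hy)]

/-- A Herglotz function which is symmetric with respect to `A` is given by a density equal to
`1 / 2` on `A`. -/
theorem exists_density_of_boundary_eq {A : Set ℝ} (hA : MeasurableSet A) {H Fp : ℂ → ℂ} {a : ℝ}
    {ν : Measure (OnePoint ℝ)} [IsFiniteMeasure ν]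
    (hrep : ∀ z : ℂ, 0 < z.im → H z = a + ∫ t, herglotzKernel z t ∂ν)
    (hFp : IsHerglotz Fp) (hFm : IsHerglotz fun z => H z - Fp z)
    (hb : ∀ᵐ t : ℝ ∂(volume.restrict A), ∃ wp wm : ℂ,
      Tendsto (fun y : ℝ => Fp (t + y * I)) (𝓝[>] 0) (𝓝 wp) ∧
      Tendsto (fun y : ℝ => H (t + y * I) - Fp (t + y * I)) (𝓝[>] 0) (𝓝 wm) ∧
      wp.im = wm.im) :
    ∃ ap : ℝ, ∃ f : OnePoint ℝ → ℝ, Measurable f ∧ (∀ t, f t ∈ Set.Icc (0 : ℝ) 1) ∧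
      (∀ᵐ t : ℝ ∂(volume.restrict A), f (t : OnePoint ℝ) = 1 / 2) ∧
      ∀ z : ℂ, 0 < z.im → Fp z = ap + ∫ t, f t • herglotzKernel z t ∂ν := by
  obtain ⟨ap, νp, hνp, hrepp⟩ := hFp.exists_representation
  obtain ⟨am, νm, hνm, hrepm⟩ := hFm.exists_representation
  have hν : ν = νp + νm := by
    refine measure_eq_of_integral_herglotzKernel_eq (a := a) (a' := ap + am) fun z hz => ?_
    rw [← hrep z hz, integral_add_measure (integrable_herglotzKernel νp hz)
      (integrable_herglotzKernel νm hz), ← sub_add_cancel (H z) (Fp z), hrepm z hz, hrepp z hz]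
    push_cast
    ring
  have hden : ∀ᵐ t ∂(volume.restrict A),
      (finitePart νp).rnDeriv volume t = (finitePart νm).rnDeriv volume t := by
    filter_upwards [hb, ae_restrict_of_ae (ae_rnDeriv_toReal_eq_of_tendsto hrepp),
      ae_restrict_of_ae (ae_rnDeriv_toReal_eq_of_tendsto hrepm),
      ae_restrict_of_ae ((finitePart νp).rnDeriv_lt_top volume),
      ae_restrict_of_ae ((finitePart νm).rnDeriv_lt_top volume)]
      with t ⟨wp, wm, hwp, hwm, heq⟩ hp hm hpt hmt
    rw [hp wp hwp, hm wm hwm] at heq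
    have h1 : (1 + t ^ 2 : ℝ) ≠ 0 := by positivity
    exact (ENNReal.toReal_eq_toReal_iff' hpt.ne hmt.ne).1
      (mul_left_cancel₀ fatouConst_pos.ne' (mul_left_cancel₀ h1 heq))
  obtain ⟨S, hS, hS0, hres⟩ := exists_null_restrict_diff_eq hA hden
  obtain ⟨f, hfm, hf01, hfB, hfν⟩ := exists_density_eq_half (ν₁ := νp) (ν₂ := νm)
    (B := ((↑) : ℝ → OnePoint ℝ) '' (A \ S))
    (measurableEmbedding_onePoint_coe.measurableSet_image' (hA.diff hS))
    (by rw [← map_restrict_finitePart, ← map_restrict_finitePart, hres])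
  refine ⟨ap, f, hfm, hf01, ?_, fun z hz => ?_⟩
  · filter_upwards [ae_restrict_mem hA, ae_restrict_of_ae (measure_eq_zero_iff_ae_notMem.1 hS0)]
      with t htA htS
    exact hfB _ ⟨t, ⟨htA, htS⟩, rfl⟩
  · rw [hrepp z hz, ← integral_withDensity_ofReal ν hfm fun x => (hf01 x).1, hν, ← hfν]

/-- Almost everywhere on the set where the density `f` is `1 / 2`, the boundary values of the
imaginary part of the Herglotz integral of `fν` are one half of those of `ν`. -/
lemma ae_im_eq_half_of_density {A : Set ℝ} {H Fp : ℂ → ℂ} {a ap : ℝ}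
    {ν : Measure (OnePoint ℝ)} [IsFiniteMeasure ν]
    (hrep : ∀ z : ℂ, 0 < z.im → H z = a + ∫ t, herglotzKernel z t ∂ν)
    {f : OnePoint ℝ → ℝ} (hfm : Measurable f) (hf01 : ∀ t, f t ∈ Set.Icc (0 : ℝ) 1)
    (hfA : ∀ᵐ t : ℝ ∂(volume.restrict A), f (t : OnePoint ℝ) = 1 / 2)
    (hrepp : ∀ z : ℂ, 0 < z.im → Fp z = ap + ∫ t, f t • herglotzKernel z t ∂ν) :
    ∀ᵐ t : ℝ ∂(volume.restrict A), ∀ w wp : ℂ,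
      Tendsto (fun y : ℝ => H (t + y * I)) (𝓝[>] 0) (𝓝 w) →
      Tendsto (fun y : ℝ => Fp (t + y * I)) (𝓝[>] 0) (𝓝 wp) → wp.im = w.im / 2 := by
  have hle : (ν.withDensity fun x => ENNReal.ofReal (f x)) ≤ ν := by
    calc (ν.withDensity fun x => ENNReal.ofReal (f x)) ≤ ν.withDensity 1 :=
          withDensity_mono (ae_of_all _ fun x => by simpa using (hf01 x).2)
      _ = ν := withDensity_one
  have : IsFiniteMeasure (ν.withDensity fun x => ENNReal.ofReal (f x)) :=
    isFiniteMeasure_of_le ν hle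
  have hrepp' (z : ℂ) (hz : 0 < z.im) : Fp z = ap +
      ∫ t, herglotzKernel z t ∂(ν.withDensity fun x => ENNReal.ofReal (f x)) := by
    rw [hrepp z hz, integral_withDensity_ofReal ν hfm fun x => (hf01 x).1]
  have hrn : (finitePart (ν.withDensity fun x => ENNReal.ofReal (f x))).rnDeriv volume =ᵐ[volume]
      fun t : ℝ => ENNReal.ofReal (f t) * (finitePart ν).rnDeriv volume t := by
    rw [finitePart_withDensity]
    exact Measure.rnDeriv_withDensity_left
      (hfm.comp measurableEmbedding_onePoint_coe.measurable).ennreal_ofReal.aemeasurable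
      (ae_of_all _ fun _ => ENNReal.ofReal_ne_top)
  filter_upwards [hfA, ae_restrict_of_ae hrn,
    ae_restrict_of_ae (ae_rnDeriv_toReal_eq_of_tendsto hrep),
    ae_restrict_of_ae (ae_rnDeriv_toReal_eq_of_tendsto hrepp')] with t hft ht h hp w wp hw hwp
  rw [h w hw, hp wp hwp, ht, hft, ENNReal.toReal_mul, ENNReal.toReal_ofReal (by norm_num)]
  ring

/-- If `f` is a density in `[0, 1]` equal to `1 / 2` on `A` and `H` has purely imaginary boundary
values on `A`, then removing `fν` from `ν` leaves a Herglotz function. -/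
theorem isHerglotz_sub_of_density {A : Set ℝ} (hApos : 0 < volume A) {H Fp : ℂ → ℂ}
    (hH : IsHerglotz H) (hFp : IsHerglotz Fp)
    (hbH : ∀ᵐ t : ℝ ∂(volume.restrict A), ∃ w : ℂ,
      Tendsto (fun y : ℝ => H (t + y * I)) (𝓝[>] 0) (𝓝 w) ∧ w.re = 0)
    {a ap : ℝ} {ν : Measure (OnePoint ℝ)} [IsFiniteMeasure ν]
    (hrep : ∀ z : ℂ, 0 < z.im → H z = a + ∫ t, herglotzKernel z t ∂ν)
    {f : OnePoint ℝ → ℝ} (hfm : Measurable f) (hf01 : ∀ t, f t ∈ Set.Icc (0 : ℝ) 1)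
    (hfA : ∀ᵐ t : ℝ ∂(volume.restrict A), f (t : OnePoint ℝ) = 1 / 2)
    (hrepp : ∀ z : ℂ, 0 < z.im → Fp z = ap + ∫ t, f t • herglotzKernel z t ∂ν) :
    IsHerglotz fun z => H z - Fp z := by
  have hint {z : ℂ} (hz : 0 < z.im) : Integrable (fun t => f t • herglotzKernel z t) ν := by
    have hK := integrable_herglotzKernel ν hz
    refine hK.mono (hfm.aestronglyMeasurable.smul hK.1) (ae_of_all _ fun t => ?_)
    rw [norm_smul, Real.norm_of_nonneg (hf01 t).1]
    exact mul_le_of_le_one_left (norm_nonneg _) (hf01 t).2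
  have hne : ¬ f =ᵐ[ν] fun _ => 1 := fun hf1 => by
    have hFpH (z : ℂ) (hz : 0 < z.im) : Fp z = H z + (ap - a) := by
      have : ∫ t, f t • herglotzKernel z t ∂ν = ∫ t, herglotzKernel z t ∂ν :=
        integral_congr_ae (by filter_upwards [hf1] with t ht; rw [ht, one_smul])
      rw [hrepp z hz, hrep z hz, this]
      ring
    have hfalse : ∀ᵐ _ : ℝ ∂(volume.restrict A), False := by
      filter_upwards [hbH, ae_im_eq_half_of_density hrep hfm hf01 hfA hrepp,
        ae_restrict_of_ae hH.ae_not_tendsto_zero] with t ⟨w, hw, hre⟩ him hnz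
      have hwp : Tendsto (fun y : ℝ => Fp (t + y * I)) (𝓝[>] 0) (𝓝 (w + (ap - a))) := by
        refine (hw.add_const _).congr' ?_
        filter_upwards [self_mem_nhdsWithin] with y hy
        exact (hFpH _ (by simpa using hy)).symm
      have h := him w _ hw hwp
      simp only [add_im, sub_im, ofReal_im, sub_self, add_zero] at h
      have hw0 : w = 0 := Complex.ext hre (by simp only [zero_im]; linarith)
      exact hnz (hw0 ▸ hw)
    rw [eventually_false_iff_eq_bot, ae_eq_bot, Measure.restrict_eq_zero] at hfalse
    exact hApos.ne' hfalse
  refine ⟨hH.1.sub hFp.1, fun z hz => ?_⟩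
  have hK := integrable_herglotzKernel ν hz
  have him : (H z - Fp z).im = ∫ t, (1 - f t) * (herglotzKernel z t).im ∂ν := by
    have : (∫ t, (herglotzKernel z t - f t • herglotzKernel z t) ∂ν).im =
        ∫ t, (herglotzKernel z t - f t • herglotzKernel z t).im ∂ν :=
      (integral_im (hK.sub (hint hz))).symm
    rw [integral_sub hK (hint hz)] at this
    rw [hrep z hz, hrepp z hz]
    simp only [sub_im, add_im, ofReal_im, zero_add, real_smul, im_ofReal_mul] at this ⊢
    rw [this]
    simp only [sub_mul, one_mul]
  have hnn (t : OnePoint ℝ) : 0 ≤ (1 - f t) * (herglotzKernel z t).im :=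
    mul_nonneg (sub_nonneg.2 (hf01 t).2) (herglotzKernel_im_pos hz t).le
  have hintim : Integrable (fun t => (1 - f t) * (herglotzKernel z t).im) ν := by
    have := (hK.sub (hint hz)).im
    refine this.congr (ae_of_all _ fun t => ?_)
    simp [sub_mul]
  rw [him]
  refine lt_of_le_of_ne (integral_nonneg hnn) fun h => hne ?_
  filter_upwards [(integral_eq_zero_iff_of_nonneg hnn hintim).1 h.symm] with t ht
  rcases mul_eq_zero.1 ht with h | h
  · linarith
  · exact absurd h (herglotzKernel_im_pos hz t).ne'

theorem stmt11 (A : Set ℝ) (hA : MeasurableSet A) (hApos : 0 < MeasureTheory.volume A)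
    (H : ℂ → ℂ) (hH : IsHerglotz H)
    -- Re H(t) = 0 for a.e. t ∈ A (boundary values)
    (hbH : ∀ᵐ t : ℝ ∂(MeasureTheory.volume.restrict A), ∃ w : ℂ,
      Tendsto (fun y : ℝ => H (t + y * Complex.I)) (𝓝[>] 0) (𝓝 w) ∧ w.re = 0)
    -- Herglotz representation of H
    (a : ℝ) (ν : Measure (OnePoint ℝ)) (hfin : IsFiniteMeasure ν) (hne : ν ≠ 0)
    (hrep : ∀ z : ℂ, 0 < z.im → H z = a + ∫ t, herglotzKernel z t ∂ν)
    (Fp : ℂ → ℂ) (hFp : IsHerglotz Fp) :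
    -- (a) F₋ = H - F₊ is Herglotz and F₊(t) = −conj(F₋(t)) for a.e. t ∈ A
    ((IsHerglotz (fun z => H z - Fp z)) ∧
      ∀ᵐ t : ℝ ∂(MeasureTheory.volume.restrict A), ∃ wp wm : ℂ,
        Tendsto (fun y : ℝ => Fp (t + y * Complex.I)) (𝓝[>] 0) (𝓝 wp) ∧
        Tendsto (fun y : ℝ => H (t + y * Complex.I) - Fp (t + y * Complex.I))
          (𝓝[>] 0) (𝓝 wm) ∧
        wp = -(starRingEnd ℂ) wm)
    ↔
    -- (b) F₊(z) = a₊ + ∫ (1+tz)/(t−z) f(t) dν(t) with 0 ≤ f ≤ 1, f = 1/2 a.e. on A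
    (∃ ap : ℝ, ∃ f : OnePoint ℝ → ℝ, Measurable f ∧ (∀ t, f t ∈ Set.Icc (0 : ℝ) 1) ∧
      (∀ᵐ t : ℝ ∂(MeasureTheory.volume.restrict A), f ((t : ℝ) : OnePoint ℝ) = 1 / 2) ∧
      ∀ z : ℂ, 0 < z.im → Fp z = ap + ∫ t, f t • herglotzKernel z t ∂ν) := by
  constructor
  · rintro ⟨hFm, hb⟩
    refine exists_density_of_boundary_eq hA hrep hFp hFm ?_
    filter_upwards [hb] with t ⟨wp, wm, hwp, hwm, heq⟩
    exact ⟨wp, wm, hwp, hwm, by simp [heq]⟩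
  · rintro ⟨ap, f, hfm, hf01, hfA, hrepp⟩
    refine ⟨isHerglotz_sub_of_density hApos hH hFp hbH hrep hfm hf01 hfA hrepp, ?_⟩
    filter_upwards [hbH, ae_restrict_of_ae hFp.ae_tendsto,
      ae_im_eq_half_of_density hrep hfm hf01 hfA hrepp] with t ⟨w, hw, hre⟩ ⟨wp, hwp⟩ him
    have him := him w wp hw hwp
    refine ⟨wp, w - wp, hwp, hw.sub hwp, Complex.ext ?_ ?_⟩
    · simp [hre]
    · simp
      linarith
end

section
/- Let F be a Herglotz function, let S ⊆ ℝ be a Borel set, and let g : ℝ → [0,1] be a Borel measurable function such that ω_{F(t+iy')}(S) → g(t) as y' → 0+ for Lebesgue-almost every t ∈ ℝ. Then for every z = x+iy ∈ ℂ⁺, ω_{F(z)}(S) = (1/π) ∫_ℝ ( y/((t−x)² + y²) ) g(t) dt. -/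
open Filter Topology MeasureTheory Complex

/-- Harmonic measure of a Borel set S ⊆ ℝ seen from z ∈ ℂ⁺. -/
noncomputable def harmMeas (z : ℂ) (S : Set ℝ) : ℝ :=
  (1 / Real.pi) * ∫ t in S, z.im / ((t - z.re) ^ 2 + z.im ^ 2)

theorem integral_poissonKernel_mul {z : ℂ} (hz : 0 < z.im) (k : ℝ → ℝ) :
    ∫ t : ℝ, (z.im / ((t - z.re) ^ 2 + z.im ^ 2)) * k t =
      (1 / 2) * ∫ θ in (0 : ℝ)..(2 * Real.pi),
        k (z.re + z.im * Real.tan ((θ - Real.pi) / 2)) := by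
  have hcos : ∀ θ ∈ Set.Ioo 0 (2 * Real.pi), 0 < Real.cos ((θ - Real.pi) / 2) := fun θ hθ =>
    Real.cos_pos_of_mem_Ioo ⟨by linarith [hθ.1], by linarith [hθ.2]⟩
  have himage : (fun θ : ℝ => z.re + z.im * Real.tan ((θ - Real.pi) / 2)) ''
      Set.Ioo 0 (2 * Real.pi) = Set.univ := by
    refine Set.eq_univ_of_forall fun t => ⟨2 * Real.arctan ((t - z.re) / z.im) + Real.pi, ?_, ?_⟩
    · constructor
      · linarith [Real.neg_pi_div_two_lt_arctan ((t - z.re) / z.im)]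
      · linarith [Real.arctan_lt_pi_div_two ((t - z.re) / z.im)]
    · have : (2 * Real.arctan ((t - z.re) / z.im) + Real.pi - Real.pi) / 2 =
          Real.arctan ((t - z.re) / z.im) := by ring
      simp only [this, Real.tan_arctan]
      field_simp
      ring
  have hinj : Set.InjOn (fun θ : ℝ => z.re + z.im * Real.tan ((θ - Real.pi) / 2))
      (Set.Ioo 0 (2 * Real.pi)) := by
    intro a ha b hb hab
    have h1 : Real.tan ((a - Real.pi) / 2) = Real.tan ((b - Real.pi) / 2) :=
      mul_left_cancel₀ hz.ne' (add_left_cancel hab)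
    have h2 := Real.injOn_tan (by constructor <;> linarith [ha.1, ha.2])
      (by constructor <;> linarith [hb.1, hb.2]) h1
    linarith
  have hderiv : ∀ θ ∈ Set.Ioo 0 (2 * Real.pi),
      HasDerivWithinAt (fun θ : ℝ => z.re + z.im * Real.tan ((θ - Real.pi) / 2))
        (z.im * (1 / Real.cos ((θ - Real.pi) / 2) ^ 2 * (1 / 2)))
        (Set.Ioo 0 (2 * Real.pi)) θ := by
    intro θ hθ
    have h1 : HasDerivAt (fun θ : ℝ => (θ - Real.pi) / 2) (1 / 2) θ :=
      ((hasDerivAt_id θ).sub_const Real.pi).div_const 2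
    exact ((((Real.hasDerivAt_tan (hcos θ hθ).ne').comp θ h1).const_mul z.im).const_add
      z.re).hasDerivWithinAt
  have hcov := integral_image_eq_integral_abs_deriv_smul measurableSet_Ioo hderiv hinj
    (fun t : ℝ => (z.im / ((t - z.re) ^ 2 + z.im ^ 2)) * k t)
  rw [himage, setIntegral_univ] at hcov
  rw [hcov, intervalIntegral.integral_of_le (by positivity), integral_Ioc_eq_integral_Ioo,
    ← integral_const_mul]
  refine setIntegral_congr_fun measurableSet_Ioo fun θ hθ => ?_
  have hc := hcos θ hθ
  have hz' := hz.ne'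
  have hsq := Real.sin_sq_add_cos_sq ((θ - Real.pi) / 2)
  simp only [smul_eq_mul, add_sub_cancel_left]
  rw [abs_of_pos (by positivity), ← mul_assoc]
  congr 1
  have h : (z.im * Real.tan ((θ - Real.pi) / 2)) ^ 2 + z.im ^ 2 =
      z.im ^ 2 / Real.cos ((θ - Real.pi) / 2) ^ 2 := by
    rw [Real.tan_eq_sin_div_cos]
    field_simp
    exact hsq
  rw [h]
  field_simp

theorem integral_poissonKernel {z : ℂ} (hz : 0 < z.im) :
    ∫ t : ℝ, z.im / ((t - z.re) ^ 2 + z.im ^ 2) = Real.pi := by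
  have h := integral_poissonKernel_mul hz fun _ => 1
  simpa using h

theorem integrable_poissonKernel {z : ℂ} (hz : 0 < z.im) :
    Integrable fun t : ℝ => z.im / ((t - z.re) ^ 2 + z.im ^ 2) :=
  Integrable.of_integral_ne_zero (by rw [integral_poissonKernel hz]; exact Real.pi_ne_zero)

theorem poissonKernel_nonneg {z : ℂ} (hz : 0 < z.im) (t : ℝ) :
    0 ≤ z.im / ((t - z.re) ^ 2 + z.im ^ 2) := by positivity

theorem harmMeas_mem_Icc {z : ℂ} (hz : 0 < z.im) (S : Set ℝ) :
    harmMeas z S ∈ Set.Icc (0 : ℝ) 1 := by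
  have hle : ∫ t in S, z.im / ((t - z.re) ^ 2 + z.im ^ 2) ≤ Real.pi :=
    (setIntegral_le_integral (integrable_poissonKernel hz)
      (ae_of_all _ (poissonKernel_nonneg hz))).trans_eq (integral_poissonKernel hz)
  have hnn : 0 ≤ ∫ t in S, z.im / ((t - z.re) ^ 2 + z.im ^ 2) :=
    integral_nonneg (poissonKernel_nonneg hz)
  unfold harmMeas
  refine ⟨by positivity, ?_⟩
  rw [one_div, inv_mul_le_iff₀ Real.pi_pos]
  simpa using hle

theorem sq_norm_ofReal_sub (t : ℝ) (w : ℂ) :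
    ‖(t : ℂ) - w‖ ^ 2 = (t - w.re) ^ 2 + w.im ^ 2 := by
  rw [← Complex.normSq_eq_norm_sq, Complex.normSq_apply]
  simp
  ring

theorem im_inv_ofReal_sub (t : ℝ) (w : ℂ) :
    ((t - w : ℂ)⁻¹).im = w.im / ((t - w.re) ^ 2 + w.im ^ 2) := by
  rw [Complex.inv_im, Complex.normSq_eq_norm_sq, sq_norm_ofReal_sub]
  simp

theorem ofReal_sub_ne_zero {w : ℂ} (hw : 0 < w.im) (t : ℝ) : (t : ℂ) - w ≠ 0 := by
  intro h
  have := congrArg Complex.im h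
  simp at this
  exact hw.ne' this

theorem integrable_inv_sq_norm_ofReal_sub {w : ℂ} (hw : 0 < w.im) :
    Integrable fun t : ℝ => (‖(t : ℂ) - w‖ ^ 2)⁻¹ := by
  refine ((integrable_poissonKernel hw).const_mul w.im⁻¹).congr (ae_of_all _ fun t => ?_)
  simp only [sq_norm_ofReal_sub]
  have := hw.ne'
  field_simp

theorem integrable_inv_ofReal_sub_sub {w v : ℂ} (hw : 0 < w.im) (hv : 0 < v.im) :
    Integrable fun t : ℝ => (t - w : ℂ)⁻¹ - (t - v : ℂ)⁻¹ := by
  refine (((integrable_inv_sq_norm_ofReal_sub hw).add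
    (integrable_inv_sq_norm_ofReal_sub hv)).const_mul ‖w - v‖).mono'
    (Measurable.aestronglyMeasurable (by fun_prop)) (ae_of_all _ fun t => ?_)
  have h1 := ofReal_sub_ne_zero hw t
  have h2 := ofReal_sub_ne_zero hv t
  have h : (t - w : ℂ)⁻¹ - (t - v : ℂ)⁻¹ = (w - v) * ((t - w : ℂ)⁻¹ * (t - v : ℂ)⁻¹) := by
    field_simp
    ring
  rw [h, norm_mul, norm_mul, norm_inv, norm_inv]
  simp only [Pi.add_apply, ← inv_pow]
  gcongr
  nlinarith [sq_nonneg (‖(t : ℂ) - w‖⁻¹ - ‖(t : ℂ) - v‖⁻¹), sq_nonneg (‖(t : ℂ) - w‖⁻¹),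
    sq_nonneg (‖(t : ℂ) - v‖⁻¹)]

theorem differentiableOn_integral_inv_ofReal_sub_sub {v : ℂ} (hv : 0 < v.im) (S : Set ℝ) :
    DifferentiableOn ℂ (fun w => ∫ t in S, ((t - w : ℂ)⁻¹ - (t - v : ℂ)⁻¹))
      {w : ℂ | 0 < w.im} := by
  intro w hw
  simp only [Set.mem_ofPred_eq] at hw
  have hnear : ∀ x ∈ Metric.ball w (w.im / 2), w.im / 2 < x.im := by
    intro x hx
    have h1 : |(x - w).im| < w.im / 2 :=
      (Complex.abs_im_le_norm _).trans_lt (by simpa [dist_eq_norm] using hx)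
    rw [Complex.sub_im] at h1
    linarith [(abs_lt.1 h1).1]
  refine (hasDerivAt_integral_of_dominated_loc_of_deriv_le
    (F' := fun x (t : ℝ) => ((t - x : ℂ) ^ 2)⁻¹)
    (bound := fun t : ℝ => 4 * (‖(t : ℂ) - w‖ ^ 2)⁻¹)
    (Metric.ball_mem_nhds w (half_pos hw)) ?_ ?_ ?_ ?_ ?_ ?_).2.differentiableAt.differentiableWithinAt
  · exact Eventually.of_forall fun x => Measurable.aestronglyMeasurable (by fun_prop)
  · exact (integrable_inv_ofReal_sub_sub hw hv).integrableOn
  · exact Measurable.aestronglyMeasurable (by fun_prop)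
  · refine ae_of_all _ fun t x hx => ?_
    have hxi := hnear x hx
    have hx0 : 0 < x.im := (half_pos hw).trans hxi
    have h1 : x.im ≤ ‖(t : ℂ) - x‖ := by
      have := Complex.abs_im_le_norm ((t : ℂ) - x)
      simp only [Complex.sub_im, Complex.ofReal_im, zero_sub, abs_neg] at this
      exact (le_abs_self _).trans this
    have h2 : ‖(t : ℂ) - w‖ ≤ ‖(t : ℂ) - x‖ + ‖x - w‖ := norm_sub_le_norm_sub_add_norm_sub _ _ _
    have h3 : ‖x - w‖ < w.im / 2 := by simpa [dist_eq_norm] using hx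
    have h4 : 0 < ‖(t : ℂ) - w‖ := norm_pos_iff.2 (ofReal_sub_ne_zero hw t)
    have h5 : 0 < ‖(t : ℂ) - x‖ := norm_pos_iff.2 (ofReal_sub_ne_zero hx0 t)
    rw [norm_inv, norm_pow, ← div_eq_mul_inv, inv_eq_one_div,
      div_le_div_iff₀ (by positivity) (by positivity)]
    nlinarith
  · exact ((integrable_inv_sq_norm_ofReal_sub hw).const_mul 4).integrableOn
  · refine ae_of_all _ fun t x hx => ?_
    have hx0 : 0 < x.im := (half_pos hw).trans (hnear x hx)
    have h := (((hasDerivAt_id x).const_sub (t : ℂ)).inv (ofReal_sub_ne_zero hx0 t)).sub_const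
      ((t - v : ℂ)⁻¹)
    simpa using h

theorem exists_differentiableOn_im_eq_harmMeas (S : Set ℝ) :
    ∃ G : ℂ → ℂ, DifferentiableOn ℂ G {w : ℂ | 0 < w.im} ∧
      ∀ w : ℂ, 0 < w.im → (G w).im = harmMeas w S := by
  have hI : 0 < Complex.I.im := by simp
  refine ⟨fun w => ((1 / Real.pi : ℝ) : ℂ) * (∫ t in S, ((t - w : ℂ)⁻¹ - (t - Complex.I : ℂ)⁻¹)) +
    (harmMeas Complex.I S : ℝ) * Complex.I,
    ((differentiableOn_integral_inv_ofReal_sub_sub hI S).const_mul _).add_const _, ?_⟩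
  intro w hw
  have h1 := Complex.imCLM.integral_comp_comm
    ((integrable_inv_ofReal_sub_sub hw hI).integrableOn (s := S))
  simp only [Complex.imCLM_apply, Complex.sub_im] at h1
  simp only [im_inv_ofReal_sub] at h1
  rw [integral_sub (integrable_poissonKernel hw).integrableOn
    (integrable_poissonKernel hI).integrableOn] at h1
  rw [Complex.add_im, Complex.im_ofReal_mul, ← h1]
  simp only [harmMeas, Complex.im_ofReal_mul, Complex.I_im]
  ring

theorem im_cayley (ζ : ℂ) :
    (Complex.I * (1 + ζ) / (1 - ζ)).im = (1 - ‖ζ‖ ^ 2) / ‖1 - ζ‖ ^ 2 := by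
  rw [Complex.div_im, ← Complex.normSq_eq_norm_sq, ← Complex.normSq_eq_norm_sq, ← sub_div]
  congr 1
  simp [Complex.normSq_apply]
  ring

theorem cayley_circleMap {θ : ℝ} (hθ : θ ∈ Set.Ioo 0 (2 * Real.pi)) :
    circleMap 0 1 θ ≠ 1 ∧ Complex.I * (1 + circleMap 0 1 θ) / (1 - circleMap 0 1 θ) =
      Real.tan ((θ - Real.pi) / 2) := by
  have hsin : 0 < Real.sin (θ / 2) :=
    Real.sin_pos_of_pos_of_lt_pi (by linarith [hθ.1]) (by linarith [hθ.2])
  have htan : Real.tan ((θ - Real.pi) / 2) = -(Real.cos (θ / 2) / Real.sin (θ / 2)) := by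
    rw [sub_div, Real.tan_eq_sin_div_cos, Real.sin_sub_pi_div_two, Real.cos_sub_pi_div_two, neg_div]
  set s := Real.sin (θ / 2) with hs
  set c := Real.cos (θ / 2) with hc
  have hsq : (s : ℂ) ^ 2 + (c : ℂ) ^ 2 = 1 := by
    exact_mod_cast Real.sin_sq_add_cos_sq (θ / 2)
  have hs0 : (s : ℂ) ≠ 0 := by exact_mod_cast hsin.ne'
  have hmap : circleMap 0 1 θ = ((c : ℂ) + s * Complex.I) ^ 2 := by
    rw [hs, hc, Complex.ofReal_cos, Complex.ofReal_sin, ← Complex.exp_mul_I, ← Complex.exp_nat_mul,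
      circleMap_zero, Complex.ofReal_one, one_mul]
    congr 1
    push_cast
    ring
  have hne : (c : ℂ) + s * Complex.I ≠ 0 := by
    intro h
    have : circleMap 0 1 θ = 0 := by rw [hmap, h]; simp
    exact circleMap_ne_center one_ne_zero this
  have hden : 1 - circleMap 0 1 θ = -2 * Complex.I * s * ((c : ℂ) + s * Complex.I) := by
    rw [hmap]
    linear_combination -hsq + (s : ℂ) ^ 2 * Complex.I_sq
  have hnum : 1 + circleMap 0 1 θ = 2 * c * ((c : ℂ) + s * Complex.I) := by
    rw [hmap]
    linear_combination -hsq + (s : ℂ) ^ 2 * Complex.I_sq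
  constructor
  · intro h
    have h0 : -2 * Complex.I * s * ((c : ℂ) + s * Complex.I) = 0 := by rw [← hden, h, sub_self]
    exact mul_ne_zero (mul_ne_zero (by simp) hs0) hne h0
  · rw [htan, hnum, hden]
    push_cast
    have := Complex.I_ne_zero
    rw [div_eq_iff (by simp [hs0, hne])]
    field_simp

/-- The Poisson integral formula on horizontal lines inside the half-plane. -/
theorem im_add_mul_I_eq_integral_poissonKernel {G : ℂ → ℂ} {C : ℝ}
    (hG : DifferentiableOn ℂ G {w : ℂ | 0 < w.im}) (hC : ∀ w : ℂ, 0 < w.im → |(G w).im| ≤ C)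
    {z : ℂ} (hz : 0 < z.im) {ε : ℝ} (hε : 0 < ε) :
    (G (z + ε * Complex.I)).im = (1 / Real.pi) *
      ∫ t : ℝ, (z.im / ((t - z.re) ^ 2 + z.im ^ 2)) * (G (t + ε * Complex.I)).im := by
  set φ : ℂ → ℂ := fun ζ => z.re + z.im * (Complex.I * (1 + ζ) / (1 - ζ)) + ε * Complex.I with hφ
  have him : ∀ ζ : ℂ, ‖ζ‖ ≤ 1 → 0 < (φ ζ).im := by
    intro ζ hζ
    have h : (φ ζ).im = z.im * ((1 - ‖ζ‖ ^ 2) / ‖1 - ζ‖ ^ 2) + ε := by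
      rw [← im_cayley]
      simp only [hφ, Complex.add_im, Complex.im_ofReal_mul, Complex.ofReal_im, Complex.I_im]
      ring
    have : 0 ≤ 1 - ‖ζ‖ ^ 2 := by nlinarith [norm_nonneg ζ]
    rw [h]
    positivity
  have hdiff : ∀ ζ : ℂ, ‖ζ‖ ≤ 1 → ζ ≠ 1 → DifferentiableAt ℂ (G ∘ φ) ζ := by
    intro ζ hζ hζ1
    have h0 : 1 - ζ ≠ 0 := sub_ne_zero.2 hζ1.symm
    refine DifferentiableAt.comp ζ (hG.differentiableAt
      ((isOpen_lt continuous_const Complex.continuous_im).mem_nhds (him ζ hζ))) ?_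
    simp only [hφ]
    fun_prop (disch := assumption)
  have hmean : ∀ r ∈ Set.Ioo (0 : ℝ) 1,
      ∫ θ in (0 : ℝ)..(2 * Real.pi), (G (φ (circleMap 0 r θ))).im =
        2 * Real.pi * (G (z + ε * Complex.I)).im := by
    intro r hr
    have hcl : ∀ ζ ∈ Metric.closedBall (0 : ℂ) r, DifferentiableAt ℂ (G ∘ φ) ζ := by
      intro ζ hζ
      have h1 : ‖ζ‖ ≤ r := by simpa using hζ
      refine hdiff ζ (h1.trans hr.2.le) ?_
      rintro rfl
      rw [norm_one] at h1
      exact absurd hr.2 h1.not_gt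
    have hdc : DiffContOnCl ℂ (G ∘ φ) (Metric.ball 0 |r|) := by
      rw [abs_of_pos hr.1]
      refine DifferentiableOn.diffContOnCl ?_
      rw [closure_ball _ hr.1.ne']
      exact fun ζ hζ => (hcl ζ hζ).differentiableWithinAt
    have h1 := hdc.circleAverage
    have hint : CircleIntegrable (G ∘ φ) 0 r := by
      refine ContinuousOn.circleIntegrable hr.1.le fun ζ hζ => ?_
      exact (hcl ζ (Metric.sphere_subset_closedBall hζ)).continuousAt.continuousWithinAt
    have h2 := Complex.imCLM.circleAverage_comp_comm hint
    rw [h1, Real.circleAverage_def] at h2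
    have h3 : φ 0 = z + ε * Complex.I := by
      simp only [hφ]
      rw [add_zero, sub_zero, div_one, mul_one, Complex.re_add_im]
    simp only [Function.comp_apply, Complex.imCLM_apply, h3, smul_eq_mul] at h2
    rw [← h2]
    field_simp
  have hlim : Tendsto (fun r : ℝ => ∫ θ in (0 : ℝ)..(2 * Real.pi), (G (φ (circleMap 0 r θ))).im)
      (𝓝[<] 1) (𝓝 (∫ θ in (0 : ℝ)..(2 * Real.pi), (G (φ (circleMap 0 1 θ))).im)) := by
    have hr : ∀ᶠ r : ℝ in 𝓝[<] 1, r ∈ Set.Ioo (0 : ℝ) 1 := Ioo_mem_nhdsLT one_pos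
    refine intervalIntegral.tendsto_integral_filter_of_dominated_convergence (fun _ => C) ?_ ?_ ?_ ?_
    · filter_upwards [hr] with r hr
      refine Continuous.aestronglyMeasurable (Complex.continuous_im.comp ?_)
      refine continuous_iff_continuousAt.2 fun θ => ?_
      have hn : ‖circleMap 0 r θ‖ = r := by simp [abs_of_pos hr.1]
      refine ContinuousAt.comp (f := circleMap 0 r) (g := G ∘ φ)
        (hdiff _ (hn.trans_le hr.2.le) ?_).continuousAt (continuous_circleMap 0 r).continuousAt
      intro h
      rw [h, norm_one] at hn
      exact hr.2.ne' hn
    · filter_upwards [hr] with r hr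
      refine ae_of_all _ fun θ _ => hC _ (him _ ?_)
      simpa [abs_of_pos hr.1] using hr.2.le
    · exact intervalIntegrable_const
    · have hne : ∀ᵐ θ : ℝ, θ ≠ 2 * Real.pi := by simp [ae_iff]
      filter_upwards [hne] with θ hθ hmem
      rw [Set.uIoc_of_le (by positivity)] at hmem
      have h1 := (cayley_circleMap ⟨hmem.1, lt_of_le_of_ne hmem.2 hθ⟩).1
      have hc : ContinuousAt (fun r : ℝ => circleMap 0 r θ) 1 := by
        simp only [circleMap]
        fun_prop
      have h2 : ContinuousAt (fun r : ℝ => (G ∘ φ) (circleMap 0 r θ)) 1 :=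
        ContinuousAt.comp (f := fun r : ℝ => circleMap 0 r θ) (g := G ∘ φ)
          (hdiff _ (by simp) h1).continuousAt hc
      exact ((Complex.continuous_im.continuousAt.comp h2).tendsto).mono_left nhdsWithin_le_nhds
  have heq := tendsto_nhds_unique (hlim.congr'
    (f₂ := fun _ => 2 * Real.pi * (G (z + ε * Complex.I)).im)
    (by filter_upwards [Ioo_mem_nhdsLT one_pos] with r hr using hmean r hr)) tendsto_const_nhds
  rw [integral_poissonKernel_mul hz]
  have hbd : ∫ θ in (0 : ℝ)..(2 * Real.pi), (G (φ (circleMap 0 1 θ))).im =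
      ∫ θ in (0 : ℝ)..(2 * Real.pi),
        (G ((z.re + z.im * Real.tan ((θ - Real.pi) / 2) : ℝ) + ε * Complex.I)).im := by
    rw [intervalIntegral.integral_of_le (by positivity),
      intervalIntegral.integral_of_le (by positivity), integral_Ioc_eq_integral_Ioo,
      integral_Ioc_eq_integral_Ioo]
    refine setIntegral_congr_fun measurableSet_Ioo fun θ hθ => ?_
    simp only [hφ, (cayley_circleMap hθ).2]
    push_cast
    rfl
  rw [← hbd, heq]
  field_simp

theorem stmt14 (F : ℂ → ℂ) (hF : IsHerglotz F) (S : Set ℝ) (hS : MeasurableSet S)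
    (g : ℝ → ℝ) (hgmeas : Measurable g) (hgbd : ∀ t, g t ∈ Set.Icc (0 : ℝ) 1)
    (hbdry : ∀ᵐ t : ℝ, Tendsto (fun y' : ℝ => harmMeas (F (t + y' * Complex.I)) S)
      (𝓝[>] 0) (𝓝 (g t))) :
    ∀ z : ℂ, 0 < z.im →
      harmMeas (F z) S =
        (1 / Real.pi) * ∫ t : ℝ, (z.im / ((t - z.re) ^ 2 + z.im ^ 2)) * g t := by
  intro z hz
  obtain ⟨H, hH, hHim⟩ := exists_differentiableOn_im_eq_harmMeas S
  have hmaps : Set.MapsTo F {w : ℂ | 0 < w.im} {w : ℂ | 0 < w.im} := fun w hw => hF.2 w hw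
  have hG : DifferentiableOn ℂ (H ∘ F) {w : ℂ | 0 < w.im} := hH.comp hF.1 hmaps
  have hGim : ∀ w : ℂ, 0 < w.im → ((H ∘ F) w).im = harmMeas (F w) S :=
    fun w hw => hHim _ (hF.2 w hw)
  have hbd : ∀ w : ℂ, 0 < w.im → |((H ∘ F) w).im| ≤ 1 := by
    intro w hw
    have h := harmMeas_mem_Icc (hF.2 w hw) S
    rw [hGim w hw, abs_of_nonneg h.1]
    exact h.2
  have hopen : IsOpen {w : ℂ | 0 < w.im} := isOpen_lt continuous_const Complex.continuous_im
  have hup : ∀ (t : ℝ) {ε : ℝ}, 0 < ε → 0 < ((t : ℂ) + ε * Complex.I).im := by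
    intro t ε hε
    simpa using hε
  have hleft : Tendsto (fun ε : ℝ => ((H ∘ F) (z + ε * Complex.I)).im) (𝓝[>] 0)
      (𝓝 (harmMeas (F z) S)) := by
    rw [← hGim z hz]
    have h1 : ContinuousAt (H ∘ F) (z + ((0 : ℝ) : ℂ) * Complex.I) := by
      simpa using (hG.differentiableAt (hopen.mem_nhds hz)).continuousAt
    have h2 : ContinuousAt (fun ε : ℝ => (H ∘ F) (z + ε * Complex.I)) 0 :=
      ContinuousAt.comp (f := fun ε : ℝ => z + ε * Complex.I) h1 (by fun_prop)
    have h3 := (Complex.continuous_im.continuousAt.comp h2).tendsto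
    simp only [Function.comp_apply, Complex.ofReal_zero, zero_mul, add_zero] at h3
    exact h3.mono_left nhdsWithin_le_nhds
  have hright : Tendsto (fun ε : ℝ => ∫ t : ℝ, (z.im / ((t - z.re) ^ 2 + z.im ^ 2)) *
      ((H ∘ F) (t + ε * Complex.I)).im) (𝓝[>] 0)
      (𝓝 (∫ t : ℝ, (z.im / ((t - z.re) ^ 2 + z.im ^ 2)) * g t)) := by
    refine tendsto_integral_filter_of_dominated_convergence _ ?_ ?_
      (integrable_poissonKernel hz) ?_
    · filter_upwards [self_mem_nhdsWithin] with ε hε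
      refine (integrable_poissonKernel hz).aestronglyMeasurable.mul
        (Continuous.aestronglyMeasurable (Complex.continuous_im.comp ?_))
      refine continuous_iff_continuousAt.2 fun t => ?_
      exact ContinuousAt.comp (f := fun t : ℝ => (t : ℂ) + ε * Complex.I) (g := H ∘ F)
        (hG.differentiableAt (hopen.mem_nhds (hup t hε))).continuousAt (by fun_prop)
    · filter_upwards [self_mem_nhdsWithin] with ε hε
      refine ae_of_all _ fun t => ?_
      rw [norm_mul, Real.norm_of_nonneg (poissonKernel_nonneg hz t)]
      exact mul_le_of_le_one_right (poissonKernel_nonneg hz t) (hbd _ (hup t hε))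
    · filter_upwards [hbdry] with t ht
      refine Tendsto.const_mul _ (ht.congr' ?_)
      filter_upwards [self_mem_nhdsWithin] with ε hε
      exact (hGim _ (hup t hε)).symm
  refine tendsto_nhds_unique (hleft.congr' ?_) (hright.const_mul (1 / Real.pi))
  filter_upwards [self_mem_nhdsWithin] with ε hε
  exact im_add_mul_I_eq_integral_poissonKernel hG hbd hz hε
end
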